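/- arXiv:math/9905064 — 2 statements merged into one kernel-verified Lean document; each statement's English description precedes it below -/
import Mathlib

section
/- Let α = {a_1,…,a_{2k}} ⊆ {1,…,ℓ} with |α| = 2k ≥ 4, write S_α(m_1,…,m_{|α|}) = h_{a_1}(−m_1)···h_{a_{|α|}}(−m_{|α|})𝟏 for positive integers m_i, and let S_α = S_{α_1}*···*S_{α_k} in A(𝓗^+) for any partition α = α_1∪···∪α_k into 2-element subsets, where S_{{a,b}} = h_a(−1)h_b(−1)𝟏. Then S_α(m_1,…,m_{|α|}) + O(𝓗^+) = (−1)^{m_1+···+m_{|α|}} S_α + O(𝓗^+), and S_α does not depend on the chosen partition. -/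
/-!
Common framework: vertex operator algebras over ℂ encoded via their modes,
weak/admissible/ordinary modules, twisted modules, Zhu's algebra data,
and the free bosonic (Heisenberg) vertex operator algebra `𝓗 = M(1)` of rank `ℓ`
together with its `θ`-fixed subalgebra `𝓗⁺`.
-/

open scoped BigOperators DirectSum TensorProduct

noncomputable section

/-- Generalized binomial coefficient `(q choose n)` for `q : ℚ`. -/
def qchoose (q : ℚ) : ℕ → ℚ
  | 0 => 1
  | n + 1 => qchoose q n * (q - n) / (n + 1)

/-- Generalized binomial coefficient of an integer, as a complex number. -/
def zchoose (m : ℤ) (n : ℕ) : ℂ := ((qchoose (m : ℚ) n : ℚ) : ℂ)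

/-- A vertex operator algebra over `ℂ`, encoded through its modes:
`Y u n : Module.End ℂ V` is the `n`-th mode `u_n` of the vertex operator `Y(u,z)`.
The axioms are: truncation, the vacuum and creation axioms, the (component form of
the) Jacobi/Borcherds identity, a lower-truncated `ℤ`-grading by `L(0)`-eigenvalues
with finite dimensional homogeneous pieces compatible with the modes, the Virasoro
relations for the conformal vector and the `L(-1)`-derivative (translation) axiom. -/
structure VOA (V : Type) [AddCommGroup V] [Module ℂ V] : Type where
  Y : V →ₗ[ℂ] ℤ → Module.End ℂ V
  one : V
  omega : V
  wt : ℤ → Submodule ℂ V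
  centralCharge : ℂ
  internal : DirectSum.IsInternal wt
  one_wt : one ∈ wt 0
  omega_wt : omega ∈ wt 2
  one_ne_zero : one ≠ 0
  fdim : ∀ n : ℤ, FiniteDimensional ℂ (wt n)
  bounded_below : ∃ N : ℤ, ∀ n : ℤ, n < N → wt n = ⊥
  trunc : ∀ u v : V, ∃ N : ℤ, ∀ n : ℤ, N ≤ n → Y u n v = 0
  vacuum_act : ∀ n : ℤ, Y one n = if n = -1 then (1 : Module.End ℂ V) else 0
  create : ∀ u : V, Y u (-1) one = u
  create_ge : ∀ (u : V) (n : ℤ), 0 ≤ n → Y u n one = 0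
  mode_wt : ∀ (k : ℤ) (u : V), u ∈ wt k → ∀ (m n : ℤ) (v : V), v ∈ wt m →
    Y u n v ∈ wt (m + k - n - 1)
  L0_diag : ∀ (n : ℤ) (v : V), v ∈ wt n → Y omega 1 v = (n : ℂ) • v
  translation : ∀ (u : V) (n : ℤ), Y (Y omega 0 u) n = (-(n : ℂ)) • Y u (n - 1)
  virasoro : ∀ m n : ℤ,
    Y omega (m + 1) * Y omega (n + 1) - Y omega (n + 1) * Y omega (m + 1)
      = ((m : ℂ) - (n : ℂ)) • Y omega (m + n + 1)
        + (if m + n = 0 then (((m ^ 3 - m : ℤ) : ℂ) / 12) * centralCharge else 0)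
            • (1 : Module.End ℂ V)
  borcherds : ∀ (u v w : V) (p m n : ℤ),
    ∑ᶠ i : ℕ, zchoose m i • Y (Y u (p + i) v) (m + n - i) w
      = ∑ᶠ i : ℕ, ((-1 : ℂ) ^ i * zchoose p i) •
          (Y u (m + p - i) (Y v (n + i) w)
            - ((-1 : ℂ) ^ p) • Y v (n + p - i) (Y u (m + i) w))

variable {V : Type} [AddCommGroup V] [Module ℂ V]

/-- Simplicity of a vertex operator algebra: the only subspaces invariant under
all modes are `0` and the whole space. -/
def VOA.Simple (A : VOA V) : Prop :=
  ∀ U : Submodule ℂ V, (∀ (u : V) (n : ℤ) (v : V), v ∈ U → A.Y u n v ∈ U) → U = ⊥ ∨ U = ⊤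

/-- The decomposition of a vertex operator algebra into its homogeneous pieces. -/
noncomputable def VOA.decompose (A : VOA V) : V ≃ₗ[ℂ] ⨁ n : ℤ, A.wt n :=
  (LinearEquiv.ofBijective (DirectSum.coeLinearMap A.wt) A.internal).symm

/-- The homogeneous component of weight `n` of a vector. -/
noncomputable def VOA.hcomp (A : VOA V) (n : ℤ) (u : V) : V := (A.decompose u n : V)

/-- Zhu's product `u * v` for `u` (treated as) homogeneous of weight `k`:
`u*v = ∑_{i≥0} (k choose i) u_{i-1} v`. -/
noncomputable def VOA.mulAux (A : VOA V) (k : ℤ) (u v : V) : V :=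
  ∑ᶠ i : ℕ, zchoose k i • A.Y u ((i : ℤ) - 1) v

/-- Zhu's circle product `u ∘ v` for `u` (treated as) homogeneous of weight `k`:
`u∘v = ∑_{i≥0} (k choose i) u_{i-2} v`. -/
noncomputable def VOA.circAux (A : VOA V) (k : ℤ) (u v : V) : V :=
  ∑ᶠ i : ℕ, zchoose k i • A.Y u ((i : ℤ) - 2) v

/-- Zhu's product `u * v`, extended bilinearly via homogeneous components of `u`. -/
noncomputable def VOA.star (A : VOA V) (u v : V) : V :=
  ∑ᶠ k : ℤ, A.mulAux k (A.hcomp k u) v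

/-- The subspace `O(V)` spanned by all circle products `u ∘ v` with `u` homogeneous;
Zhu's algebra is `A(V) = V/O(V)` with product induced by `VOA.star`. -/
def VOA.Osub (A : VOA V) : Submodule ℂ V :=
  Submodule.span ℂ {w | ∃ (k : ℤ) (u v : V), u ∈ A.wt k ∧ w = A.circAux k u v}

/-- A weak module for a vertex operator algebra, given by modes satisfying
truncation, the vacuum axiom and the Borcherds identity. -/
structure WkMod (A : VOA V) (M : Type) [AddCommGroup M] [Module ℂ M] : Type where
  act : V →ₗ[ℂ] ℤ → Module.End ℂ M
  trunc : ∀ (u : V) (w : M), ∃ N : ℤ, ∀ n : ℤ, N ≤ n → act u n w = 0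
  vacuum_act : ∀ n : ℤ, act A.one n = if n = -1 then (1 : Module.End ℂ M) else 0
  borcherds : ∀ (u v : V) (w : M) (p m n : ℤ),
    ∑ᶠ i : ℕ, zchoose m i • act (A.Y u (p + i) v) (m + n - i) w
      = ∑ᶠ i : ℕ, ((-1 : ℂ) ^ i * zchoose p i) •
          (act u (m + p - i) (act v (n + i) w)
            - ((-1 : ℂ) ^ p) • act v (n + p - i) (act u (m + i) w))

/-- An admissible (`ℕ`-gradable) module for a vertex operator algebra:
a weak module with an `ℕ`-grading with nonzero top level, compatible with weights. -/
structure AdmMod (A : VOA V) (M : Type) [AddCommGroup M] [Module ℂ M]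
    extends WkMod A M : Type where
  gr : ℕ → Submodule ℂ M
  grInternal : DirectSum.IsInternal gr
  top_ne_bot : gr 0 ≠ ⊥
  gr_mode : ∀ (k : ℤ) (u : V), u ∈ A.wt k → ∀ (m : ℤ) (n : ℕ) (w : M), w ∈ gr n →
    act u m w ∈
      if 0 ≤ (n : ℤ) + k - m - 1 then gr ((n : ℤ) + k - m - 1).toNat else ⊥

/-- An ordinary module for a vertex operator algebra: a weak module on which `L(0)`
acts semisimply with finite dimensional eigenspaces whose weights are truncated from
below in each coset `λ + ℤ`. -/
structure OrdMod (A : VOA V) (M : Type) [AddCommGroup M] [Module ℂ M]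
    extends WkMod A M : Type where
  wtm : ℂ → Submodule ℂ M
  indep : iSupIndep wtm
  spans : ⨆ c : ℂ, wtm c = ⊤
  L0_diag : ∀ (c : ℂ) (w : M), w ∈ wtm c → act A.omega 1 w = c • w
  fdim : ∀ c : ℂ, FiniteDimensional ℂ (wtm c)
  bounded_below : ∀ c : ℂ, ∃ N : ℤ, ∀ m : ℤ, m < N → wtm (c + m) = ⊥

/-- Irreducibility of a weak module. -/
def WkMod.Irreducible {A : VOA V} {M : Type} [AddCommGroup M] [Module ℂ M]
    (P : WkMod A M) : Prop :=
  (∃ w : M, w ≠ 0) ∧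
    ∀ U : Submodule ℂ M, (∀ (u : V) (n : ℤ) (w : M), w ∈ U → P.act u n w ∈ U) →
      U = ⊥ ∨ U = ⊤

/-- Isomorphism of two weak modules over the same vertex operator algebra. -/
def ModIso (A : VOA V) {M N : Type} [AddCommGroup M] [Module ℂ M]
    [AddCommGroup N] [Module ℂ N] (P : WkMod A M) (Q : WkMod A N) : Prop :=
  ∃ f : M ≃ₗ[ℂ] N, ∀ (u : V) (n : ℤ) (w : M), f (P.act u n w) = Q.act u n (f w)

/-- The action of the zero-mode `o(u) = u_{wt u - 1}` (extended linearly from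
homogeneous vectors) on a weak module; it preserves the top level of an
admissible module. -/
noncomputable def WkMod.oAct {A : VOA V} {M : Type} [AddCommGroup M] [Module ℂ M]
    (Q : WkMod A M) (u : V) (w : M) : M :=
  ∑ᶠ k : ℤ, Q.act (A.hcomp k u) (k - 1) w

/-- Action of a word of creation operators `h_{a_1}(-n_1) ⋯ h_{a_k}(-n_k)`. -/
def wordAct {ℓ : ℕ} {M : Type} (f : Fin ℓ → ℤ → M → M) : List (Fin ℓ × ℕ+) → M → M
  | [], w => w
  | (a, n) :: L, w => f a (-((n : ℕ) : ℤ)) (wordAct f L w)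

/-- Action of a word of twisted creation operators
`h_{a_1}(-n_1+1/2) ⋯ h_{a_k}(-n_k+1/2)` (indices doubled). -/
def twWordAct {ℓ : ℕ} {M : Type} (f : Fin ℓ → ℤ → M → M) : List (Fin ℓ × ℕ+) → M → M
  | [], w => w
  | (a, n) :: L, w => f a (-(2 * ((n : ℕ) : ℤ) - 1)) (twWordAct f L w)

/-- `A` is the rank `ℓ` free bosonic (Heisenberg) vertex operator algebra
`𝓗 = M(1)`, with generators `hgen a = h_a(-1)𝟏` for an orthonormal basis
`h_1, …, h_ℓ` of `𝔥`: the generators have weight one, their modes satisfy the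
Heisenberg commutation relations `[h_a(m), h_b(n)] = m δ_{ab} δ_{m+n,0}`, the
conformal vector is `ω = (1/2) ∑_a h_a(-1)²𝟏`, and `V` is spanned by the vectors
`h_{a_1}(-n_1) ⋯ h_{a_k}(-n_k)𝟏`. -/
structure IsHeisenberg {ℓ : ℕ} (A : VOA V) (hgen : Fin ℓ → V) : Prop where
  wt_one : ∀ a, hgen a ∈ A.wt 1
  heis_comm : ∀ (a b : Fin ℓ) (m n : ℤ),
    A.Y (hgen a) m * A.Y (hgen b) n - A.Y (hgen b) n * A.Y (hgen a) m
      = (if a = b ∧ m + n = 0 then (m : ℂ) else 0) • (1 : Module.End ℂ V)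
  omega_eq : A.omega
      = (1 / 2 : ℂ) • ∑ a : Fin ℓ, A.Y (hgen a) (-1) (A.Y (hgen a) (-1) A.one)
  span_words : Submodule.span ℂ
      {v : V | ∃ L : List (Fin ℓ × ℕ+),
        v = wordAct (fun a k w => A.Y (hgen a) k w) L A.one} = ⊤

/-- `θ` is the automorphism of the free bosonic vertex operator algebra induced
by `-1` on `𝔥`. -/
structure IsThetaAut {ℓ : ℕ} (A : VOA V) (hgen : Fin ℓ → V) (θ : V ≃ₗ[ℂ] V) : Prop where
  map_one : θ A.one = A.one
  map_omega : θ A.omega = A.omega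
  map_Y : ∀ (u : V) (n : ℤ) (v : V), θ (A.Y u n v) = A.Y (θ u) n (θ v)
  map_gen : ∀ a, θ (hgen a) = -hgen a
  map_wt : ∀ (k : ℤ) (v : V), v ∈ A.wt k → θ v ∈ A.wt k

/-- `B` (with underlying space `W`, embedded in `V` by `ι`) is the fixed point
vertex operator subalgebra `V^θ` of the involution `θ`. -/
structure IsFixedSubVOA {W : Type} [AddCommGroup W] [Module ℂ W]
    (A : VOA V) (θ : V ≃ₗ[ℂ] V) (B : VOA W) (ι : W →ₗ[ℂ] V) : Prop where
  inj : Function.Injective ι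
  range_eq : LinearMap.range ι
      = Module.End.eigenspace (θ.toLinearMap : Module.End ℂ V) 1
  map_one : ι B.one = A.one
  map_omega : ι B.omega = A.omega
  map_Y : ∀ (u : W) (n : ℤ) (v : W), ι (B.Y u n v) = A.Y (ι u) n (ι v)
  map_wt : ∀ (k : ℤ) (w : W), w ∈ B.wt k ↔ ι w ∈ A.wt k

/-- `P` is (isomorphic to) the Fock module `M(1,λ)` over the rank `ℓ` Heisenberg
vertex operator algebra: it has a nonzero vector `v₀` with `h_a(n)v₀ = 0` for
`n ≥ 1`, `h_a(0)v₀ = λ_a v₀`, which generates `M` under the creation operators. -/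
def IsFockModule {ℓ : ℕ} {M : Type} [AddCommGroup M] [Module ℂ M]
    (A : VOA V) (hgen : Fin ℓ → V) (P : WkMod A M) (lam : Fin ℓ → ℂ) : Prop :=
  ∃ v0 : M, v0 ≠ 0 ∧ (∀ (a : Fin ℓ) (n : ℤ), 1 ≤ n → P.act (hgen a) n v0 = 0) ∧
    (∀ a : Fin ℓ, P.act (hgen a) 0 v0 = lam a • v0) ∧
    Submodule.span ℂ {w : M | ∃ L : List (Fin ℓ × ℕ+),
      w = wordAct (fun a k x => P.act (hgen a) k x) L v0} = ⊤

/-- A weak `θ`-twisted module (for an involution `θ`): the modes are indexed by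
`(1/2)ℤ`, encoded here by doubling (so `act u k` is the mode `u_{k/2}`); on the
eigenspace `θ = (-1)^r` only modes with `k ≡ r (mod 2)` act, and the component
form of the twisted Jacobi identity holds. -/
structure TwMod (A : VOA V) (θ : V ≃ₗ[ℂ] V) (M : Type) [AddCommGroup M]
    [Module ℂ M] : Type where
  act : V →ₗ[ℂ] ℤ → Module.End ℂ M
  trunc : ∀ (u : V) (w : M), ∃ N : ℤ, ∀ n : ℤ, N ≤ n → act u n w = 0
  vacuum_act : ∀ n : ℤ, act A.one n = if n = -2 then (1 : Module.End ℂ M) else 0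
  moding : ∀ (u : V) (r : ℤ), θ u = ((-1 : ℂ) ^ r) • u →
    ∀ k : ℤ, (k - r) % 2 ≠ 0 → act u k = 0
  borcherds : ∀ (u v : V) (r s : ℤ), θ u = ((-1 : ℂ) ^ r) • u →
    θ v = ((-1 : ℂ) ^ s) • v → ∀ (w : M) (p K N : ℤ),
    ∑ᶠ i : ℕ, ((qchoose ((K : ℚ) / 2) i : ℚ) : ℂ) • act (A.Y u (p + i) v) (K + N - 2 * i) w
      = ∑ᶠ i : ℕ, ((-1 : ℂ) ^ i * zchoose p i) •
          (act u (K + 2 * p - 2 * i) (act v (N + 2 * i) w)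
            - ((-1 : ℂ) ^ p) • act v (N + 2 * p - 2 * i) (act u (K + 2 * i) w))

/-- Irreducibility of a twisted module. -/
def TwMod.Irreducible {A : VOA V} {θ : V ≃ₗ[ℂ] V} {M : Type} [AddCommGroup M]
    [Module ℂ M] (T : TwMod A θ M) : Prop :=
  (∃ w : M, w ≠ 0) ∧
    ∀ U : Submodule ℂ M, (∀ (u : V) (k : ℤ) (w : M), w ∈ U → T.act u k w ∈ U) →
      U = ⊥ ∨ U = ⊤

/-- `T` is (isomorphic to) the canonical irreducible `θ`-twisted module
`𝓗(θ) = S(𝔥 ⊗ t^{-1/2}ℂ[t^{-1/2}])` of the rank `ℓ` free bosonic vertex operator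
algebra: it has a nonzero vector killed by all modes `h_a(k/2)`, `k ≥ 1`, which
generates it under the twisted creation operators. -/
def IsCanonicalTwMod {ℓ : ℕ} {M : Type} [AddCommGroup M] [Module ℂ M]
    (A : VOA V) (hgen : Fin ℓ → V) {θ : V ≃ₗ[ℂ] V} (T : TwMod A θ M) : Prop :=
  ∃ v0 : M, v0 ≠ 0 ∧ (∀ (a : Fin ℓ) (k : ℤ), 1 ≤ k → T.act (hgen a) k v0 = 0) ∧
    Submodule.span ℂ {w : M | ∃ L : List (Fin ℓ × ℕ+),
      w = twWordAct (fun a k x => T.act (hgen a) k x) L v0} = ⊤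

/-- `σ` is the canonical involution of the twisted module `𝓗(θ)` (acting by
`(-1)^k` on monomials of length `k`): it is an involution compatible with `θ`
through the twisted action and fixing the lowest weight vectors. -/
def TwInvolution {ℓ : ℕ} {M : Type} [AddCommGroup M] [Module ℂ M]
    (A : VOA V) (hgen : Fin ℓ → V) {θ : V ≃ₗ[ℂ] V} (T : TwMod A θ M)
    (σ : M ≃ₗ[ℂ] M) : Prop :=
  (∀ w : M, σ (σ w) = w) ∧
  (∀ (u : V) (k : ℤ) (w : M), σ (T.act u k w) = T.act (θ u) k (σ w)) ∧
  (∀ v0 : M, (∀ (a : Fin ℓ) (k : ℤ), 1 ≤ k → T.act (hgen a) k v0 = 0) → σ v0 = v0)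

/-- The weak `B = V^θ`-module `Q` "is" the eigenspace `V^{(ε)}` of `θ` on `V`
(e.g. `𝓗⁺` itself for `ε = 1` and `𝓗⁻` for `ε = -1`), with action obtained by
restricting the vertex operators of `V`. -/
def IsEigenPartModule {W N : Type} [AddCommGroup W] [Module ℂ W]
    [AddCommGroup N] [Module ℂ N] (A : VOA V) (θ : V ≃ₗ[ℂ] V) {B : VOA W}
    (ι : W →ₗ[ℂ] V) (ε : ℂ) (Q : WkMod B N) : Prop :=
  ∃ j : N →ₗ[ℂ] V, Function.Injective j ∧
    LinearMap.range j = Module.End.eigenspace (θ.toLinearMap : Module.End ℂ V) ε ∧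
    ∀ (u : W) (n : ℤ) (w : N), j (Q.act u n w) = A.Y (ι u) n (j w)

/-- The weak `B = V^θ`-module `Q` "is" the eigenspace `𝓗(θ)^{(ε)}` of the
involution `σ` on the twisted module `𝓗(θ)`, with the restricted twisted action
(`u ∈ V^θ` acts by its integral modes). -/
def IsTwEigenPartModule {W MT N : Type} [AddCommGroup W] [Module ℂ W]
    [AddCommGroup MT] [Module ℂ MT] [AddCommGroup N] [Module ℂ N]
    (A : VOA V) {θ : V ≃ₗ[ℂ] V} {B : VOA W} (ι : W →ₗ[ℂ] V)
    (T : TwMod A θ MT) (σ : MT ≃ₗ[ℂ] MT) (ε : ℂ) (Q : WkMod B N) : Prop :=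
  ∃ j : N →ₗ[ℂ] MT, Function.Injective j ∧
    LinearMap.range j = Module.End.eigenspace (σ.toLinearMap : Module.End ℂ MT) ε ∧
    ∀ (u : W) (n : ℤ) (w : N), j (Q.act u n w) = T.act (ι u) (2 * n) (j w)

/-- The weak `B = 𝓗⁺`-module `Q` "is" the restriction to `𝓗⁺` of the Fock module
`M(1,λ)`. -/
def IsFockRestriction {ℓ : ℕ} {W N : Type} [AddCommGroup W] [Module ℂ W]
    [AddCommGroup N] [Module ℂ N] (A : VOA V) (hgen : Fin ℓ → V) {B : VOA W}
    (ι : W →ₗ[ℂ] V) (lam : Fin ℓ → ℂ) (Q : WkMod B N) : Prop :=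
  ∃ P : WkMod A N, IsFockModule A hgen P lam ∧
    ∀ (u : W) (n : ℤ), Q.act u n = P.act (ι u) n

/-- A realization of Zhu's algebra `A(V) = V/O(V)` of a vertex operator algebra
as an abstract associative `ℂ`-algebra `R`. -/
structure ZhuRealization (A : VOA V) (R : Type) [Ring R] [Algebra ℂ R] : Type where
  π : V →ₗ[ℂ] R
  surj : Function.Surjective π
  ker_eq : LinearMap.ker π = A.Osub
  map_star : ∀ u v : V, π (A.star u v) = π u * π v
  map_one : π A.one = 1

/-- The `R = A(V)`-module `M` "is" the top level `N(0)` of the admissible module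
`N`, where `[u] ∈ A(V)` acts on the top level by the zero-mode `o(u)`. -/
def IsTopLevelOf {R : Type} [Ring R] [Algebra ℂ R] {A : VOA V}
    (Z : ZhuRealization A R) {N : Type} [AddCommGroup N] [Module ℂ N]
    (Qa : AdmMod A N) (M : Type) [AddCommGroup M] [Module R M] : Prop :=
  ∃ f : M →+ N, Function.Injective f ∧ (∀ m : M, f m ∈ Qa.gr 0) ∧
    (∀ w ∈ Qa.gr 0, ∃ m : M, f m = w) ∧
    ∀ (u : V) (m : M), f (Z.π u • m) = Qa.toWkMod.oAct u (f m)

/-- Iterated Zhu product of a list of elements (an empty product is `[𝟏]`). -/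
noncomputable def starList (A : VOA V) : List V → V
  | [] => A.one
  | x :: L => A.star x (starList A L)

/-- The linear span of all Zhu-monomials in a set of generators; modulo `O(V)`
this is the subalgebra of `A(V)` generated by the images of the generators. -/
def genMonomials (A : VOA V) (gens : Set V) : Submodule ℂ V :=
  Submodule.span ℂ {w : V | ∃ L : List V, (∀ g ∈ L, g ∈ gens) ∧ w = starList A L}

/-- The subspace `𝓦^α ⊆ 𝓗` spanned by the monomials
`h_{a_1}(-n_1) ⋯ h_{a_k}(-n_k)𝟏` whose number of letters from `𝓗_c` is odd
exactly for `c ∈ α`; thus `wordSpanV A hgen ∅ = 𝓦 = 𝓗₁⁺ ⊗ ⋯ ⊗ 𝓗_ℓ⁺`. -/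
def wordSpanV {ℓ : ℕ} (A : VOA V) (hgen : Fin ℓ → V) (α : Finset (Fin ℓ)) :
    Submodule ℂ V :=
  Submodule.span ℂ {v : V | ∃ L : List (Fin ℓ × ℕ+),
    (∀ c : Fin ℓ, c ∈ α ↔ ¬ Even ((L.map Prod.fst).count c)) ∧
    v = wordAct (fun a k w => A.Y (hgen a) k w) L A.one}

/-- The element `S_{ab}(m,n) = h_a(-m)h_b(-n)𝟏` of `𝓗`. -/
def SV {ℓ : ℕ} (A : VOA V) (hgen : Fin ℓ → V) (a b : Fin ℓ) (m n : ℤ) : V :=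
  A.Y (hgen a) (-m) (A.Y (hgen b) (-n) A.one)

/-- The element `ω_a = (1/2) h_a(-1)²𝟏` of `𝓗⁺`. -/
def omegaV {ℓ : ℕ} (A : VOA V) (hgen : Fin ℓ → V) (a : Fin ℓ) : V :=
  (1 / 2 : ℂ) • SV A hgen a a 1 1

/-- The element `J_a = h_a(-1)⁴𝟏 - 2h_a(-3)h_a(-1)𝟏 + (3/2)h_a(-2)²𝟏` of `𝓗⁺`. -/
def JV {ℓ : ℕ} (A : VOA V) (hgen : Fin ℓ → V) (a : Fin ℓ) : V :=
  A.Y (hgen a) (-1) (A.Y (hgen a) (-1) (A.Y (hgen a) (-1) (A.Y (hgen a) (-1) A.one)))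
    - (2 : ℂ) • SV A hgen a a 3 1 + (3 / 2 : ℂ) • SV A hgen a a 2 2

variable {W : Type} [AddCommGroup W] [Module ℂ W]

/-- `E^u_{ab}` (for `a ≠ b`), as a combination of the `S_{ab}(1,m)`. -/
def EuW {ℓ : ℕ} (s : Fin ℓ → Fin ℓ → ℤ → ℤ → W) (a b : Fin ℓ) : W :=
  (5 : ℂ) • s a b 1 2 + (25 : ℂ) • s a b 1 3 + (36 : ℂ) • s a b 1 4 + (16 : ℂ) • s a b 1 5

/-- `E^t_{ab}` (for `a ≠ b`), as a combination of the `S_{ab}(1,m)`. -/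
def EtW {ℓ : ℕ} (s : Fin ℓ → Fin ℓ → ℤ → ℤ → W) (a b : Fin ℓ) : W :=
  (-16 : ℂ) • ((3 : ℂ) • s a b 1 2 + (14 : ℂ) • s a b 1 3 + (19 : ℂ) • s a b 1 4
    + (8 : ℂ) • s a b 1 5)

/-- `Λ_{ab}` (for `a ≠ b`), as a combination of the `S_{ab}(1,m)`. -/
def LamW {ℓ : ℕ} (s : Fin ℓ → Fin ℓ → ℤ → ℤ → W) (a b : Fin ℓ) : W :=
  (45 : ℂ) • s a b 1 2 + (190 : ℂ) • s a b 1 3 + (240 : ℂ) • s a b 1 4 + (96 : ℂ) • s a b 1 5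

/-- The full setting of the paper: `A = 𝓗` is the rank `ℓ` free bosonic vertex
operator algebra with Heisenberg generators `hgen`, `θ` is its `-1` involution,
and `B = 𝓗⁺` is the fixed point vertex operator subalgebra, embedded by `ι`. -/
structure HeisenbergPlusSetting (ℓ : ℕ) (V W : Type) [AddCommGroup V] [Module ℂ V]
    [AddCommGroup W] [Module ℂ W] : Type where
  A : VOA V
  hgen : Fin ℓ → V
  heis : IsHeisenberg A hgen
  θ : V ≃ₗ[ℂ] V
  thetaAut : IsThetaAut A hgen θ
  B : VOA W
  ι : W →ₗ[ℂ] V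
  fixedSub : IsFixedSubVOA A θ B ι

/-- Bundled weak module over a vertex operator algebra. -/
structure ARep (A : VOA V) : Type 1 where
  carrier : Type
  [acg : AddCommGroup carrier]
  [mod : Module ℂ carrier]
  str : WkMod A carrier

attribute [instance] ARep.acg ARep.mod

/-- Bundled admissible module over a vertex operator algebra. -/
structure BRep (A : VOA V) : Type 1 where
  carrier : Type
  [acg : AddCommGroup carrier]
  [mod : Module ℂ carrier]
  adm : AdmMod A carrier

attribute [instance] BRep.acg BRep.mod

/-- Bundled twisted module over a vertex operator algebra with involution. -/
structure TwRep (A : VOA V) (θ : V ≃ₗ[ℂ] V) : Type 1 where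
  carrier : Type
  [acg : AddCommGroup carrier]
  [mod : Module ℂ carrier]
  str : TwMod A θ carrier

attribute [instance] TwRep.acg TwRep.mod

end

namespace S10

variable {V : Type} [AddCommGroup V] [Module ℂ V]

theorem zchoose_zero (m : ℤ) : zchoose m 0 = 1 := by simp [zchoose, qchoose]

theorem zchoose_one (m : ℤ) : zchoose m 1 = m := by simp [zchoose, qchoose]

theorem zchoose_zero_succ (n : ℕ) : zchoose 0 (n + 1) = 0 := by
  have h : qchoose 0 (n + 1) = 0 := by
    induction n with
    | zero => simp [qchoose]
    | succ n ih => rw [qchoose, ih]; simp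
  simp [zchoose, h]

/-- Borcherds identity with vanishing annihilation part. -/
theorem mode_creation (A : VOA V) (u v w : V) (hw : ∀ i : ℕ, A.Y u i w = 0) (p n : ℤ) :
    A.Y (A.Y u p v) n w
      = ∑ᶠ i : ℕ, ((-1 : ℂ) ^ i * zchoose p i) • A.Y u (p - i) (A.Y v (n + i) w) := by
  have h := A.borcherds u v w p 0 n
  rw [finsum_eq_single _ 0] at h
  · simpa [zchoose_zero, hw] using h
  · intro i hi
    obtain ⟨j, rfl⟩ := Nat.exists_eq_succ_of_ne_zero hi
    rw [Nat.succ_eq_add_one, zchoose_zero_succ, zero_smul]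

theorem mode_gen (A : VOA V) (u w : V) (hw : ∀ i : ℕ, A.Y u i w = 0) (p : ℤ) :
    (∀ i : ℕ, A.Y (A.Y u p A.one) i w = 0) ∧
    A.Y (A.Y u p A.one) (-1) w = A.Y u p w ∧
    A.Y (A.Y u p A.one) (-2) w = (-(p : ℂ)) • A.Y u (p - 1) w := by
  refine ⟨fun n => ?_, ?_, ?_⟩
  · rw [mode_creation A u A.one w hw, finsum_eq_zero_of_forall_eq_zero]
    intro i
    rw [A.vacuum_act, if_neg (by omega)]
    simp
  · rw [mode_creation A u A.one w hw, finsum_eq_single _ 0]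
    · simp [A.vacuum_act, zchoose_zero]
    · intro i hi
      rw [A.vacuum_act, if_neg (by omega)]
      simp
  · rw [mode_creation A u A.one w hw, finsum_eq_single _ 1]
    · simp [A.vacuum_act, zchoose_one]
    · intro i hi
      rw [A.vacuum_act, if_neg (by omega)]
      simp

theorem mode_pair (A : VOA V) (u v w : V) (hu : ∀ i : ℕ, A.Y u i w = 0)
    (hv : ∀ i : ℕ, A.Y v i w = 0) (p q : ℤ) :
    (∀ i : ℕ, A.Y (A.Y u p (A.Y v q A.one)) i w = 0) ∧
    A.Y (A.Y u p (A.Y v q A.one)) (-1) w = A.Y u p (A.Y v q w) ∧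
    A.Y (A.Y u p (A.Y v q A.one)) (-2) w
      = (-(p : ℂ)) • A.Y u (p - 1) (A.Y v q w) + (-(q : ℂ)) • A.Y u p (A.Y v (q - 1) w) := by
  obtain ⟨h0, h1, h2⟩ := mode_gen A v w hv q
  refine ⟨fun n => ?_, ?_, ?_⟩
  · rw [mode_creation A u _ w hu, finsum_eq_zero_of_forall_eq_zero]
    intro i
    have := h0 (n + i)
    push_cast at this
    rw [this]; simp
  · rw [mode_creation A u _ w hu, finsum_eq_single _ 0]
    · simp [zchoose_zero, h1]
    · intro i hi
      obtain ⟨j, rfl⟩ := Nat.exists_eq_succ_of_ne_zero hi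
      have e : (-1 : ℤ) + ((j.succ : ℕ) : ℤ) = (j : ℤ) := by push_cast; ring
      rw [e, h0]; simp
  · rw [mode_creation A u _ w hu, finsum_eq_sum_of_support_subset (s := Finset.range 2)]
    · rw [Finset.sum_range_succ, Finset.sum_range_one]
      have e : (-2 : ℤ) + ((1 : ℕ) : ℤ) = -1 := by norm_num
      rw [e, h1]
      simp [zchoose_zero, zchoose_one, h2]
      abel
    · intro i hi
      by_contra hc
      apply hi
      have : 2 ≤ i := by simp at hc; omega
      obtain ⟨j, rfl⟩ := Nat.exists_eq_add_of_le this
      have e : (-2 : ℤ) + ((2 + j : ℕ) : ℤ) = (j : ℤ) := by push_cast; ring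
      simp only [e, h0]; simp

/-- words -/
def wd {ℓ : ℕ} (A : VOA V) (hgen : Fin ℓ → V) (L : List (Fin ℓ × ℕ+)) : V :=
  wordAct (fun c j w => A.Y (hgen c) j w) L A.one

theorem wd_cons {ℓ : ℕ} (A : VOA V) (hgen : Fin ℓ → V) (a : Fin ℓ) (n : ℕ+)
    (L : List (Fin ℓ × ℕ+)) :
    wd A hgen ((a, n) :: L) = A.Y (hgen a) (-((n : ℕ) : ℤ)) (wd A hgen L) := rfl

theorem comm_apply {ℓ : ℕ} {A : VOA V} {hgen : Fin ℓ → V} (H : IsHeisenberg A hgen)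
    (a b : Fin ℓ) (m n : ℤ) (h : ¬ (a = b ∧ m + n = 0)) (w : V) :
    A.Y (hgen a) m (A.Y (hgen b) n w) = A.Y (hgen b) n (A.Y (hgen a) m w) := by
  have := H.heis_comm a b m n
  rw [if_neg h, zero_smul, sub_eq_zero] at this
  exact LinearMap.congr_fun this w

theorem wd_perm {ℓ : ℕ} {A : VOA V} {hgen : Fin ℓ → V} (H : IsHeisenberg A hgen)
    {L L' : List (Fin ℓ × ℕ+)} (h : L.Perm L') : wd A hgen L = wd A hgen L' := by
  induction h with
  | nil => rfl
  | cons x _ ih => obtain ⟨a, n⟩ := x; rw [wd_cons, wd_cons, ih]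
  | swap x y L =>
    obtain ⟨a, n⟩ := x; obtain ⟨b, m⟩ := y
    simp only [wd_cons]
    apply comm_apply H
    have := n.pos; have := m.pos
    omega
  | trans _ _ h1 h2 => exact h1.trans h2

theorem wd_annih {ℓ : ℕ} {A : VOA V} {hgen : Fin ℓ → V} (H : IsHeisenberg A hgen)
    (a : Fin ℓ) (L : List (Fin ℓ × ℕ+)) (h : a ∉ L.map Prod.fst) (i : ℕ) :
    A.Y (hgen a) i (wd A hgen L) = 0 := by
  induction L with
  | nil => exact A.create_ge _ _ (by omega)
  | cons x L ih =>
    obtain ⟨b, n⟩ := x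
    simp only [List.map_cons, List.mem_cons, not_or] at h
    rw [wd_cons, comm_apply H _ _ _ _ (fun hh => h.1 hh.1), ih h.2, map_zero]

theorem hcomp_same (A : VOA V) (k : ℤ) (u : V) (hu : u ∈ A.wt k) (j : ℤ) :
    A.hcomp j u = if j = k then u else 0 := by
  have : A.decompose u = DirectSum.lof ℂ ℤ (fun n => A.wt n) k ⟨u, hu⟩ := by
    rw [VOA.decompose, LinearEquiv.symm_apply_eq]
    exact (DirectSum.coeLinearMap_lof A.wt k ⟨u, hu⟩).symm
  rw [VOA.hcomp, this]
  split_ifs with h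
  · subst h; rw [DirectSum.lof_apply]
  · rw [DirectSum.lof_eq_of, DirectSum.of_eq_of_ne _ _ _ h]; rfl

theorem star_eq (A : VOA V) (k : ℤ) (u v : V) (hu : u ∈ A.wt k) :
    A.star u v = A.mulAux k u v := by
  rw [VOA.star, finsum_eq_single _ k]
  · rw [hcomp_same A k u hu, if_pos rfl]
  · intro j hj
    rw [hcomp_same A k u hu, if_neg hj, VOA.mulAux]
    simp

variable {W : Type} [AddCommGroup W] [Module ℂ W]

theorem SV_wt {ℓ : ℕ} {A : VOA V} {hgen : Fin ℓ → V} (H : IsHeisenberg A hgen)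
    (a b : Fin ℓ) (m n : ℤ) : SV A hgen a b m n ∈ A.wt (m + n) := by
  have h1 := A.mode_wt 1 _ (H.wt_one b) 0 (-n) _ A.one_wt
  have h2 := A.mode_wt 1 _ (H.wt_one a) _ (-m) _ h1
  have e : 0 + 1 - -n - 1 + 1 - -m - 1 = m + n := by ring
  rwa [e] at h2

theorem map_fin {ℓ : ℕ} (S : HeisenbergPlusSetting ℓ V W) (f : ℕ → W) :
    S.ι (∑ᶠ i, f i) = ∑ᶠ i, S.ι (f i) :=
  AddMonoidHom.map_finsum_of_injective S.ι.toAddMonoidHom S.fixedSub.inj f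

section
variable {ℓ : ℕ} (S : HeisenbergPlusSetting ℓ V W)

theorem star_word (a b : Fin ℓ) (u v : W) (L : List (Fin ℓ × ℕ+))
    (hu : S.ι u = SV S.A S.hgen a b 1 1) (hv : S.ι v = wd S.A S.hgen L)
    (ha : a ∉ L.map Prod.fst) (hb : b ∉ L.map Prod.fst) :
    S.ι (S.B.star u v) = wd S.A S.hgen ((a, 1) :: (b, 1) :: L) := by
  have hwt : u ∈ S.B.wt (1 + 1) := by
    rw [S.fixedSub.map_wt, hu]; exact SV_wt S.heis a b 1 1
  obtain ⟨h0, h1, -⟩ := mode_pair S.A (S.hgen a) (S.hgen b) (wd S.A S.hgen L)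
    (wd_annih S.heis a L ha) (wd_annih S.heis b L hb) (-1) (-1)
  rw [star_eq _ _ _ _ hwt, VOA.mulAux, map_fin, finsum_eq_single _ 0]
  · rw [map_smul, S.fixedSub.map_Y, hu, hv, zchoose_zero, one_smul]
    simpa [SV, wd_cons] using h1
  · intro i hi
    obtain ⟨j, rfl⟩ := Nat.exists_eq_succ_of_ne_zero hi
    have e : ((j.succ : ℕ) : ℤ) - 1 = (j : ℤ) := by push_cast; ring
    rw [map_smul, S.fixedSub.map_Y, hu, hv, e, SV, h0, smul_zero]

theorem circ_word (a b : Fin ℓ) (m n : ℕ+) (u v : W) (L : List (Fin ℓ × ℕ+))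
    (hu : S.ι u = SV S.A S.hgen a b ((m : ℕ) : ℤ) ((n : ℕ) : ℤ))
    (hv : S.ι v = wd S.A S.hgen L)
    (ha : a ∉ L.map Prod.fst) (hb : b ∉ L.map Prod.fst) :
    (((m : ℕ) : ℂ) • (wd S.A S.hgen ((a, m + 1) :: (b, n) :: L)
        + wd S.A S.hgen ((a, m) :: (b, n) :: L))
      + ((n : ℕ) : ℂ) • (wd S.A S.hgen ((a, m) :: (b, n + 1) :: L)
        + wd S.A S.hgen ((a, m) :: (b, n) :: L))) ∈ S.B.Osub.map S.ι := by
  have hwt : u ∈ S.B.wt (((m : ℕ) : ℤ) + ((n : ℕ) : ℤ)) := by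
    rw [S.fixedSub.map_wt, hu]; exact SV_wt S.heis a b _ _
  obtain ⟨h0, h1, h2⟩ := mode_pair S.A (S.hgen a) (S.hgen b) (wd S.A S.hgen L)
    (wd_annih S.heis a L ha) (wd_annih S.heis b L hb) (-((m : ℕ) : ℤ)) (-((n : ℕ) : ℤ))
  refine ⟨S.B.circAux (((m : ℕ) : ℤ) + ((n : ℕ) : ℤ)) u v,
    Submodule.subset_span ⟨_, u, v, hwt, rfl⟩, ?_⟩
  rw [VOA.circAux, map_fin, finsum_eq_sum_of_support_subset (s := Finset.range 2)]
  · rw [Finset.sum_range_succ, Finset.sum_range_one]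
    have e0 : ((0 : ℕ) : ℤ) - 2 = -2 := by norm_num
    have e1 : ((1 : ℕ) : ℤ) - 2 = -1 := by norm_num
    have em : -((m : ℕ) : ℤ) - 1 = -(((m + 1 : ℕ+) : ℕ) : ℤ) := by push_cast; ring
    have en : -((n : ℕ) : ℤ) - 1 = -(((n + 1 : ℕ+) : ℕ) : ℤ) := by push_cast; ring
    rw [map_smul, map_smul, S.fixedSub.map_Y, S.fixedSub.map_Y, hu, hv, zchoose_zero,
      zchoose_one, e0, e1, SV, h1, h2, em, en]
    simp only [wd_cons]
    push_cast
    module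
  · intro i hi
    by_contra hc
    apply hi
    have : 2 ≤ i := by simp at hc; omega
    obtain ⟨j, rfl⟩ := Nat.exists_eq_add_of_le this
    have e : ((2 + j : ℕ) : ℤ) - 2 = (j : ℤ) := by push_cast; ring
    simp only [map_smul, S.fixedSub.map_Y, hu, hv, e, SV, h0, smul_zero]

theorem theta_word (L : List (Fin ℓ × ℕ+)) :
    S.θ (wd S.A S.hgen L) = ((-1 : ℂ) ^ L.length) • wd S.A S.hgen L := by
  induction L with
  | nil => simpa [wd, wordAct] using S.thetaAut.map_one
  | cons x L ih =>
    obtain ⟨b, n⟩ := x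
    rw [wd_cons, S.thetaAut.map_Y, ih, S.thetaAut.map_gen, List.length_cons, pow_succ]
    simp

theorem exists_word (L : List (Fin ℓ × ℕ+)) (h : Even L.length) :
    ∃ v : W, S.ι v = wd S.A S.hgen L := by
  have : wd S.A S.hgen L ∈ LinearMap.range S.ι := by
    rw [S.fixedSub.range_eq, Module.End.mem_eigenspace_iff]
    have := theta_word S L
    rw [h.neg_one_pow] at this
    exact this
  exact this

theorem circ_word' (a b : Fin ℓ) (m n : ℕ+) (L : List (Fin ℓ × ℕ+)) (hL : Even L.length)
    (ha : a ∉ L.map Prod.fst) (hb : b ∉ L.map Prod.fst) :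
    (((m : ℕ) : ℂ) • (wd S.A S.hgen ((a, m + 1) :: (b, n) :: L)
        + wd S.A S.hgen ((a, m) :: (b, n) :: L))
      + ((n : ℕ) : ℂ) • (wd S.A S.hgen ((a, m) :: (b, n + 1) :: L)
        + wd S.A S.hgen ((a, m) :: (b, n) :: L))) ∈ S.B.Osub.map S.ι := by
  obtain ⟨v, hv⟩ := exists_word S L hL
  obtain ⟨u, hu⟩ := exists_word S [(a, m), (b, n)] (by simp)
  exact circ_word S a b m n u v L hu hv ha hb

theorem step (a : Fin ℓ) (m : ℕ+) (L : List (Fin ℓ × ℕ+)) (hL : ¬ Even L.length)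
    (hL3 : 3 ≤ L.length) (hnd : (a :: L.map Prod.fst).Nodup) :
    wd S.A S.hgen ((a, m + 1) :: L) + wd S.A S.hgen ((a, m) :: L) ∈ S.B.Osub.map S.ι := by
  match L, hL3 with
  | (b, n) :: (c, p) :: L, _ =>
    simp only [List.map_cons, List.nodup_cons, List.mem_cons, not_or] at hnd
    obtain ⟨⟨hab, hac, haL⟩, ⟨hbc, hbL⟩, hcL, -⟩ := hnd
    have hE : Even (L.length + 1) := by
      simp only [List.length_cons] at hL
      rw [Nat.even_add_one] at hL
      simpa using hL
    have h1 := circ_word' S a b m n ((c, p) :: L) hE (by simp [hac, haL]) (by simp [hbc, hbL])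
    have h2 := circ_word' S a c m p ((b, n) :: L) hE (by simp [hab, haL])
      (by simp [Ne.symm hbc, hcL])
    have h3 := circ_word' S b c n p ((a, m) :: L) hE (by simp [Ne.symm hab, hbL])
      (by simp [Ne.symm hac, hcL])
    have sw : ∀ (x y z : Fin ℓ × ℕ+), wd S.A S.hgen (x :: z :: y :: L)
        = wd S.A S.hgen (x :: y :: z :: L) := fun x y z =>
      wd_perm S.heis ((List.Perm.swap _ _ _).cons _)
    have rot : ∀ (x y z : Fin ℓ × ℕ+), wd S.A S.hgen (y :: z :: x :: L)
        = wd S.A S.hgen (x :: y :: z :: L) := fun x y z =>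
      wd_perm S.heis (((List.Perm.swap _ _ _).cons _).trans (List.Perm.swap _ _ _))
    simp only [sw _ (b, n) (c, _)] at h2
    simp only [rot (a, m)] at h3
    have hm : ((m : ℕ) : ℂ) ≠ 0 := by simp
    have h4 := Submodule.smul_mem _ ((2 * ((m : ℕ) : ℂ))⁻¹)
      (Submodule.sub_mem _ (Submodule.add_mem _ h1 h2) h3)
    convert h4 using 1
    match_scalars <;> field_simp <;> ring

theorem step_all (a : Fin ℓ) (m : ℕ+) (L : List (Fin ℓ × ℕ+)) (hL : ¬ Even L.length)
    (hL3 : 3 ≤ L.length) (hnd : (a :: L.map Prod.fst).Nodup) :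
    ((-1 : ℂ) ^ (m : ℕ)) • wd S.A S.hgen ((a, m) :: L) + wd S.A S.hgen ((a, 1) :: L)
      ∈ S.B.Osub.map S.ι := by
  induction m with
  | one => simp
  | succ m ih =>
    have h := Submodule.sub_mem _ ih
      (Submodule.smul_mem _ ((-1 : ℂ) ^ (m : ℕ)) (step S a m L hL hL3 hnd))
    convert h using 1
    rw [PNat.add_coe, PNat.one_coe, pow_succ]
    module

theorem reduce (L R : List (Fin ℓ × ℕ+)) (hE : Even (L ++ R).length)
    (h4 : 4 ≤ (L ++ R).length) (hnd : ((L ++ R).map Prod.fst).Nodup) :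
    ((-1 : ℂ) ^ (L.map fun q => (q.2 : ℕ)).sum) • wd S.A S.hgen (L ++ R)
      - ((-1 : ℂ) ^ L.length) • wd S.A S.hgen (L.map (fun q => (q.1, (1 : ℕ+))) ++ R)
      ∈ S.B.Osub.map S.ι := by
  induction L generalizing R with
  | nil => simp
  | cons x L ih =>
    obtain ⟨a, m⟩ := x
    have pm : ∀ L' : List (Fin ℓ × ℕ+), ((a, (1 : ℕ+)) :: (L' ++ R)).Perm (L' ++ (a, 1) :: R) :=
      fun L' => List.perm_middle.symm
    have h1 := step_all S a m (L ++ R)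
      (by simp only [List.cons_append, List.length_cons, Nat.even_add_one] at hE; exact hE)
      (by simp only [List.cons_append, List.length_cons] at h4; omega) (by simpa using hnd)
    have h2 := ih ((a, 1) :: R)
      (by simp only [List.cons_append, List.length_cons, List.length_append] at hE ⊢
          rw [← add_assoc]; exact hE)
      (by simp only [List.cons_append, List.length_cons, List.length_append] at h4 ⊢
          omega)
      (by
        refine (((pm L).map Prod.fst).nodup_iff).1 ?_
        simpa using hnd)
    rw [← wd_perm S.heis (pm L), ← wd_perm S.heis (pm _)] at h2
    have h := Submodule.sub_mem _
      (Submodule.smul_mem _ ((-1 : ℂ) ^ (L.map fun q => (q.2 : ℕ)).sum) h1) h2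
    convert h using 1
    simp only [List.map_cons, List.sum_cons, List.length_cons, pow_add, pow_one, List.cons_append]
    module

theorem starList_word (s : Fin ℓ → Fin ℓ → ℤ → ℤ → W)
    (hs : ∀ a b m n, S.ι (s a b m n) = SV S.A S.hgen a b m n)
    (P : List (Fin ℓ × Fin ℓ)) (hnd : (P.flatMap fun q => [q.1, q.2]).Nodup) :
    S.ι (starList S.B (P.map fun q => s q.1 q.2 1 1))
      = wd S.A S.hgen ((P.flatMap fun q => [q.1, q.2]).map fun c => (c, (1 : ℕ+))) := by
  induction P with
  | nil => exact S.fixedSub.map_one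
  | cons q P ih =>
    obtain ⟨a, b⟩ := q
    simp only [List.flatMap_cons, List.cons_append, List.nil_append, List.nodup_cons,
      List.mem_cons, not_or] at hnd
    obtain ⟨⟨hab, haP⟩, hbP, hP⟩ := hnd
    have e : (((P.flatMap fun q => [q.1, q.2]).map fun c => (c, (1 : ℕ+))).map Prod.fst)
        = P.flatMap fun q => [q.1, q.2] := by
      rw [List.map_map]; exact List.map_id _
    simp only [List.map_cons, starList, List.flatMap_cons, List.cons_append, List.nil_append]
    exact star_word S a b _ _ _ (hs a b 1 1) (ih hP) (by rw [e]; exact haP) (by rw [e]; exact hbP)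

end

end S10

/-- Lemma 4.1.10. Let `α = {a_1,…,a_{2k}} ⊆ {1,…,ℓ}` with
`|α| = 2k ≥ 4`. For positive integers `m_j` and any partition of `α` into
2-element subsets (encoded by `pairs : Fin k → Fin ℓ × Fin ℓ` whose entries
enumerate `α`), with `S_α = S_{α_1} * ⋯ * S_{α_k}` and `S_{{a,b}} = h_a(-1)h_b(-1)𝟏`:
`S_α(m_1,…,m_{2k}) + O(𝓗⁺) = (-1)^{m_1+⋯+m_{2k}} S_α + O(𝓗⁺)`, and `S_α` is
independent of the chosen partition modulo `O(𝓗⁺)`. -/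
theorem statement10 (ℓ k : ℕ) (hk : 2 ≤ k) {V W : Type} [AddCommGroup V]
    [Module ℂ V] [AddCommGroup W] [Module ℂ W] (S : HeisenbergPlusSetting ℓ V W)
    (s : Fin ℓ → Fin ℓ → ℤ → ℤ → W)
    (hs : ∀ a b m n, S.ι (s a b m n) = SV S.A S.hgen a b m n)
    (a : Fin (2 * k) → Fin ℓ) (ha : Function.Injective a)
    (pairs pairs' : Fin k → Fin ℓ × Fin ℓ)
    (hp : (List.ofFn a).Perm ((List.ofFn pairs).flatMap fun q => [q.1, q.2]))
    (hp' : (List.ofFn a).Perm ((List.ofFn pairs').flatMap fun q => [q.1, q.2]))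
    (m : Fin (2 * k) → ℕ+)
    (x : W)
    (hx : S.ι x = wordAct (fun c j w => S.A.Y (S.hgen c) j w)
      (List.ofFn fun j => (a j, m j)) S.A.one) :
    (x - ((-1 : ℂ) ^ (∑ j, ((m j : ℕ) : ℤ))) •
      starList S.B (List.ofFn fun i => s (pairs i).1 (pairs i).2 1 1) ∈ S.B.Osub) ∧
    (starList S.B (List.ofFn fun i => s (pairs i).1 (pairs i).2 1 1)
      - starList S.B (List.ofFn fun i => s (pairs' i).1 (pairs' i).2 1 1)
        ∈ S.B.Osub) := by
  have key : ∀ ps : Fin k → Fin ℓ × Fin ℓ,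
      (List.ofFn a).Perm ((List.ofFn ps).flatMap fun q => [q.1, q.2]) →
      S.ι (starList S.B (List.ofFn fun i => s (ps i).1 (ps i).2 1 1))
        = S10.wd S.A S.hgen ((List.ofFn a).map fun c => (c, (1 : ℕ+))) := by
    intro ps h
    have e : (List.ofFn fun i => s (ps i).1 (ps i).2 1 1)
        = (List.ofFn ps).map fun q => s q.1 q.2 1 1 := by
      rw [List.map_ofFn]; rfl
    rw [e, S10.starList_word S s hs _ (h.nodup_iff.1 (List.nodup_ofFn.2 ha))]
    exact S10.wd_perm S.heis (h.symm.map _)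
  have back : ∀ y : W, S.ι y ∈ S.B.Osub.map S.ι → y ∈ S.B.Osub := by
    rintro y ⟨z, hz, hzy⟩
    rw [← S.fixedSub.inj hzy]; exact hz
  constructor
  · apply back
    rw [map_sub, map_smul, key pairs hp, hx]
    have h := S10.reduce S (List.ofFn fun j => (a j, m j)) [] (by simp) (by simp; omega)
      (by rw [List.append_nil, List.map_ofFn]; exact List.nodup_ofFn.2 ha)
    rw [List.append_nil, List.append_nil, List.map_ofFn, List.map_ofFn, List.length_ofFn,
      List.sum_ofFn, (even_two_mul k).neg_one_pow, one_smul] at h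
    have e : (∑ j, ((m j : ℕ) : ℤ)) = ((∑ j, (m j : ℕ) : ℕ) : ℤ) := by push_cast; rfl
    rw [e, zpow_natCast, List.map_ofFn]
    have h' := Submodule.smul_mem _ ((-1 : ℂ) ^ (∑ j, (m j : ℕ))) h
    rw [smul_sub, smul_smul] at h'
    simp only [Function.comp_apply] at h'
    rw [← pow_add, (Even.add_self _).neg_one_pow, one_smul] at h'
    exact h'
  · have : starList S.B (List.ofFn fun i => s (pairs i).1 (pairs i).2 1 1)
        = starList S.B (List.ofFn fun i => s (pairs' i).1 (pairs' i).2 1 1) :=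
      S.fixedSub.inj ((key pairs hp).trans (key pairs' hp').symm)
    rw [this, sub_self]
    exact Submodule.zero_mem _
end

section
/- Let α ⊆ {1,…,ℓ} with |α| even and |α| ≥ 4. Then as a left A[𝓦]-module and also as a right A[𝓦]-module, A[𝓦^α] is generated by the single element S_α = S_{α_1}*···*S_{α_k} + O(𝓗^+), for any partition of α into 2-element subsets α_i, where S_{{a,b}} = h_a(−1)h_b(−1)𝟏. -/
/-!
Common framework: vertex operator algebras over ℂ encoded via their modes,
weak/admissible/ordinary modules, twisted modules, Zhu's algebra data,
and the free bosonic (Heisenberg) vertex operator algebra `𝓗 = M(1)` of rank `ℓ`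
together with its `θ`-fixed subalgebra `𝓗⁺`.
-/

open scoped BigOperators DirectSum TensorProduct

namespace H11

section General

variable {V : Type} [AddCommGroup V] [Module ℂ V]

theorem zchoose_zero_right (m : ℤ) : zchoose m 0 = 1 := by
  simp [zchoose, qchoose]

theorem zchoose_one_right (m : ℤ) : zchoose m 1 = m := by
  simp [zchoose, qchoose]

theorem qchoose_zero_succ (n : ℕ) : qchoose 0 (n + 1) = 0 := by
  induction n with
  | zero => simp [qchoose]
  | succ n ih => rw [qchoose, ih]; simp

theorem zchoose_zero_succ (n : ℕ) : zchoose 0 (n + 1) = 0 := by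
  have := qchoose_zero_succ n
  simp [zchoose, this]

theorem finsum_mem_sub {N : Submodule ℂ V} {f : ℕ → V} (h : ∀ i, f i ∈ N) :
    ∑ᶠ i, f i ∈ N :=
  finsum_induction (fun x => x ∈ N) N.zero_mem (fun _ _ => N.add_mem) h

/-- Split off the leading terms of a finitely supported sum. -/
theorem finsum_split {N : Submodule ℂ V} {f : ℕ → V} (M : ℕ) (hM : ∀ i, M ≤ i → f i = 0)
    (k : ℕ) (h : ∀ i, k ≤ i → f i ∈ N) :
    ∑ᶠ i, f i - ∑ i ∈ Finset.range k, f i ∈ N := by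
  have h1 : ∑ᶠ i, f i = ∑ i ∈ Finset.range (k + M), f i := by
    apply finsum_eq_sum_of_support_subset
    intro i hi
    simp only [Finset.coe_range, Set.mem_Iio]
    by_contra hlt
    exact hi (hM i (by omega))
  rw [h1, Finset.sum_range_add, add_sub_cancel_left]
  exact N.sum_mem fun i _ => h _ (by omega)

theorem trunc_nat (A : VOA V) (u v : V) (c : ℤ) :
    ∃ M : ℕ, ∀ i : ℕ, M ≤ i → A.Y u (c + i) v = 0 := by
  obtain ⟨N, hN⟩ := A.trunc u v
  exact ⟨(N - c).toNat, fun i hi => hN _ (by omega)⟩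

theorem circ_lead (A : VOA V) (N : Submodule ℂ V) (k : ℤ) (u v : V)
    (h : ∀ n : ℤ, 0 ≤ n → A.Y u n v ∈ N) :
    A.circAux k u v - (A.Y u (-2) v + (k : ℂ) • A.Y u (-1) v) ∈ N := by
  obtain ⟨M, hM⟩ := trunc_nat A u v (-2)
  have := finsum_split (N := N) (f := fun i : ℕ => zchoose k i • A.Y u ((i : ℤ) - 2) v) M
    (fun i hi => by
      have := hM i hi
      rw [show (i : ℤ) - 2 = -2 + i by ring, this, smul_zero]) 2
    (fun i hi => N.smul_mem _ (h _ (by omega)))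
  simpa [Finset.sum_range_succ, zchoose_zero_right, zchoose_one_right, VOA.circAux] using this

theorem mul_lead (A : VOA V) (N : Submodule ℂ V) (k : ℤ) (u v : V)
    (h : ∀ n : ℤ, 0 ≤ n → A.Y u n v ∈ N) :
    A.mulAux k u v - A.Y u (-1) v ∈ N := by
  obtain ⟨M, hM⟩ := trunc_nat A u v (-1)
  have := finsum_split (N := N) (f := fun i : ℕ => zchoose k i • A.Y u ((i : ℤ) - 1) v) M
    (fun i hi => by
      have := hM i hi
      rw [show (i : ℤ) - 1 = -1 + i by ring, this, smul_zero]) 1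
    (fun i hi => N.smul_mem _ (h _ (by omega)))
  simpa [Finset.sum_range_succ, zchoose_zero_right, zchoose_one_right, VOA.mulAux] using this

theorem hcomp_add (A : VOA V) (k : ℤ) (u v : V) :
    A.hcomp k (u + v) = A.hcomp k u + A.hcomp k v := by
  simp [VOA.hcomp]

theorem hcomp_smul (A : VOA V) (k : ℤ) (c : ℂ) (v : V) :
    A.hcomp k (c • v) = c • A.hcomp k v := by
  simp [VOA.hcomp, DirectSum.smul_apply]

theorem hcomp_zero (A : VOA V) (k : ℤ) : A.hcomp k 0 = 0 := by
  simp [VOA.hcomp]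

theorem hcomp_of_mem (A : VOA V) (k j : ℤ) (u : V) (hu : u ∈ A.wt k) :
    A.hcomp j u = if j = k then u else 0 := by
  have h1 : A.decompose u = DirectSum.lof ℂ ℤ (fun n => A.wt n) k ⟨u, hu⟩ := by
    rw [VOA.decompose, LinearEquiv.symm_apply_eq]
    exact (DirectSum.coeLinearMap_lof A.wt k ⟨u, hu⟩).symm
  rw [VOA.hcomp, h1]
  split_ifs with h
  · subst h
    simp [DirectSum.lof_apply]
  · rw [DirectSum.lof_eq_of, DirectSum.of_eq_of_ne]
    · rfl
    · exact h

theorem exists_support (A : VOA V) (u : V) :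
    ∃ s : Finset ℤ, (∀ k, k ∉ s → A.hcomp k u = 0) ∧ u = ∑ k ∈ s, A.hcomp k u := by
  classical
  refine ⟨(A.decompose u).support, fun k hk => ?_, ?_⟩
  · have : A.decompose u k = 0 := by simpa using hk
    simp [VOA.hcomp, this]
  · have h : DirectSum.coeLinearMap A.wt (A.decompose u) = u := by
      have := (LinearEquiv.ofBijective (DirectSum.coeLinearMap A.wt) A.internal).apply_symm_apply u
      exact this
    conv_lhs => rw [← h]
    rw [DirectSum.coeLinearMap_eq_dfinsuppSum]
    rfl

theorem mulAux_zero (A : VOA V) (k : ℤ) (v : V) : A.mulAux k 0 v = 0 := by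
  simp [VOA.mulAux]

theorem star_lead (A : VOA V) (N : Submodule ℂ V) (u v : V)
    (h : ∀ k n : ℤ, 0 ≤ n → A.Y (A.hcomp k u) n v ∈ N) :
    A.star u v - A.Y u (-1) v ∈ N := by
  obtain ⟨s, hs, hu⟩ := exists_support A u
  have h1 : A.star u v = ∑ k ∈ s, A.mulAux k (A.hcomp k u) v := by
    apply finsum_eq_sum_of_support_subset
    intro k hk
    by_contra hks
    exact hk (by simp only [hs k hks, mulAux_zero])
  have h2 : A.Y u (-1) v = ∑ k ∈ s, A.Y (A.hcomp k u) (-1) v := by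
    conv_lhs => rw [hu]
    rw [map_sum, Finset.sum_apply, LinearMap.sum_apply]
  rw [h1, h2, ← Finset.sum_sub_distrib]
  exact N.sum_mem fun k _ => mul_lead A N k _ _ (h k)

/-- The mode formula for `u_p v`. -/
theorem iterate (A : VOA V) (u v w : V) (p q : ℤ) :
    A.Y (A.Y u p v) q w = ∑ᶠ i : ℕ, ((-1 : ℂ) ^ i * zchoose p i) •
          (A.Y u (p - i) (A.Y v (q + i) w)
            - ((-1 : ℂ) ^ p) • A.Y v (q + p - i) (A.Y u i w)) := by
  have h := A.borcherds u v w p 0 q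
  rw [finsum_eq_single _ 0] at h
  · simpa [zchoose_zero_right] using h
  · intro n hn
    obtain ⟨m, rfl⟩ := Nat.exists_eq_succ_of_ne_zero hn
    rw [Nat.succ_eq_add_one, zchoose_zero_succ, zero_smul]

theorem iterate_lead (A : VOA V) (N : Submodule ℂ V) (u v w : V) (p q : ℤ) (k : ℕ)
    (h1 : ∀ i : ℕ, k ≤ i → A.Y u (p - i) (A.Y v (q + i) w) ∈ N)
    (h2 : ∀ i : ℕ, A.Y v (q + p - i) (A.Y u i w) ∈ N) :
    A.Y (A.Y u p v) q w - ∑ i ∈ Finset.range k, ((-1 : ℂ) ^ i * zchoose p i) •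
          A.Y u (p - i) (A.Y v (q + i) w) ∈ N := by
  obtain ⟨M1, hM1⟩ := trunc_nat A v w q
  obtain ⟨M2, hM2⟩ := trunc_nat A u w 0
  have h3 := finsum_split (N := N) (f := fun i : ℕ => ((-1 : ℂ) ^ i * zchoose p i) •
          (A.Y u (p - i) (A.Y v (q + i) w)
            - ((-1 : ℂ) ^ p) • A.Y v (q + p - i) (A.Y u i w))) (M1 + M2)
    (fun i hi => by
      have e1 := hM1 i (by omega)
      have e2 := hM2 i (by omega)
      rw [zero_add] at e2
      simp [e1, e2]) k
    (fun i hi => N.smul_mem _ (N.sub_mem (h1 i hi) (N.smul_mem _ (h2 i))))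
  rw [← iterate] at h3
  have h4 : ∑ i ∈ Finset.range k, ((-1 : ℂ) ^ i * zchoose p i) •
      (((-1 : ℂ) ^ p) • A.Y v (q + p - i) (A.Y u i w)) ∈ N :=
    N.sum_mem fun i _ => N.smul_mem _ (N.smul_mem _ (h2 i))
  have h5 := N.sub_mem h3 h4
  convert h5 using 1
  simp only [smul_sub, Finset.sum_sub_distrib]
  abel

end General

section Heis

variable {V : Type} [AddCommGroup V] [Module ℂ V] {ℓ : ℕ}

/-- The action of a word of creation operators on a vector. -/
def wa (A : VOA V) (hgen : Fin ℓ → V) (L : List (Fin ℓ × ℕ+)) (v : V) : V :=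
  wordAct (fun a k w => A.Y (hgen a) k w) L v

theorem wa_nil (A : VOA V) (hgen : Fin ℓ → V) (v : V) : wa A hgen [] v = v := rfl

theorem wa_cons (A : VOA V) (hgen : Fin ℓ → V) (a : Fin ℓ) (m : ℕ+)
    (L : List (Fin ℓ × ℕ+)) (v : V) :
    wa A hgen ((a, m) :: L) v = A.Y (hgen a) (-((m : ℕ) : ℤ)) (wa A hgen L v) := rfl

theorem wa_append (A : VOA V) (hgen : Fin ℓ → V) (L L' : List (Fin ℓ × ℕ+)) (v : V) :
    wa A hgen (L ++ L') v = wa A hgen L (wa A hgen L' v) := by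
  induction L with
  | nil => rfl
  | cons x L ih => obtain ⟨a, m⟩ := x; rw [List.cons_append, wa_cons, wa_cons, ih]

/-- Parity vector of a word. -/
def par (L : List (Fin ℓ × ℕ+)) : Fin ℓ → ZMod 2 :=
  fun c => (((L.map Prod.fst).count c : ℕ) : ZMod 2)

def ee (a : Fin ℓ) : Fin ℓ → ZMod 2 := Pi.single a 1

theorem par_nil : par ([] : List (Fin ℓ × ℕ+)) = 0 := by
  ext c; simp [par]

theorem par_cons (a : Fin ℓ) (m : ℕ+) (L : List (Fin ℓ × ℕ+)) :
    par ((a, m) :: L) = ee a + par L := by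
  ext c
  simp only [par, ee, List.map_cons, Pi.add_apply, Pi.single_apply, List.count_cons]
  by_cases h : c = a
  · subst h; simp [add_comm]
  · have h' : ¬ a = c := fun h1 => h h1.symm
    simp [h, h']

theorem par_append (L L' : List (Fin ℓ × ℕ+)) : par (L ++ L') = par L + par L' := by
  induction L with
  | nil => simp [par_nil]
  | cons x L ih => obtain ⟨a, m⟩ := x; rw [List.cons_append, par_cons, par_cons, ih, add_assoc]

theorem par_perm {L L' : List (Fin ℓ × ℕ+)} (h : L.Perm L') : par L = par L' := by
  ext c
  simp only [par]
  rw [(h.map Prod.fst).count_eq]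

theorem dbl (p : Fin ℓ → ZMod 2) : p + p = 0 := by
  ext c; exact CharTwo.add_self_eq_zero (p c)

/-- The span of the words with at most `r` letters and parity `p`. -/
def Fil (A : VOA V) (hgen : Fin ℓ → V) (r : ℤ) (p : Fin ℓ → ZMod 2) : Submodule ℂ V :=
  Submodule.span ℂ {v | ∃ L : List (Fin ℓ × ℕ+),
    (L.length : ℤ) ≤ r ∧ par L = p ∧ v = wa A hgen L A.one}

variable {A : VOA V} {hgen : Fin ℓ → V}

theorem Fil_word (L : List (Fin ℓ × ℕ+)) {r : ℤ} {p : Fin ℓ → ZMod 2}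
    (h1 : (L.length : ℤ) ≤ r) (h2 : par L = p) : wa A hgen L A.one ∈ Fil A hgen r p :=
  Submodule.subset_span ⟨L, h1, h2, rfl⟩

theorem Fil_mono {r s : ℤ} {p q : Fin ℓ → ZMod 2} (h : r ≤ s) (hpq : p = q) {v : V}
    (hv : v ∈ Fil A hgen r p) : v ∈ Fil A hgen s q := by
  subst hpq
  refine Submodule.span_mono ?_ hv
  rintro v ⟨L, h1, h2, h3⟩
  exact ⟨L, h1.trans h, h2, h3⟩

theorem Fil_le {r : ℤ} {p : Fin ℓ → ZMod 2} {N : Submodule ℂ V}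
    (h : ∀ L : List (Fin ℓ × ℕ+), (L.length : ℤ) ≤ r → par L = p → wa A hgen L A.one ∈ N)
    {v : V} (hv : v ∈ Fil A hgen r p) : v ∈ N := by
  refine (Submodule.span_le (p := N)).2 ?_ hv
  rintro v ⟨L, h1, h2, rfl⟩
  exact h L h1 h2

theorem creat {r : ℤ} {p : Fin ℓ → ZMod 2} (a : Fin ℓ) (m : ℤ) (hm : m < 0) {v : V}
    (hv : v ∈ Fil A hgen r p) : A.Y (hgen a) m v ∈ Fil A hgen (1 + r) (ee a + p) := by
  obtain ⟨m', hm'⟩ : ∃ m' : ℕ+, m = -((m' : ℕ) : ℤ) := by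
    refine ⟨⟨m.natAbs, by omega⟩, ?_⟩
    change m = -((m.natAbs : ℕ) : ℤ)
    omega
  refine Fil_le (N := (Fil A hgen (1 + r) (ee a + p)).comap (A.Y (hgen a) m)) ?_ hv
  intro L h1 h2
  rw [Submodule.mem_comap, hm', ← wa_cons]
  refine Fil_word _ ?_ ?_
  · simp only [List.length_cons]; push_cast; omega
  · rw [par_cons, h2]

theorem creat_wa {r : ℤ} {p : Fin ℓ → ZMod 2} (L : List (Fin ℓ × ℕ+)) {v : V}
    (hv : v ∈ Fil A hgen r p) : wa A hgen L v ∈ Fil A hgen (L.length + r) (par L + p) := by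
  induction L with
  | nil => exact Fil_mono (by simp) (by simp [par_nil]) hv
  | cons x L ih =>
    obtain ⟨a, m⟩ := x
    rw [wa_cons]
    have hm := m.pos
    exact Fil_mono (by simp only [List.length_cons]; push_cast; omega)
      (by rw [par_cons, add_assoc]) (creat a _ (by omega) ih)

theorem comm_apply (H : IsHeisenberg A hgen) (a b : Fin ℓ) (m n : ℤ) (v : V) :
    A.Y (hgen a) m (A.Y (hgen b) n v) = A.Y (hgen b) n (A.Y (hgen a) m v)
      + (if a = b ∧ m + n = 0 then (m : ℂ) else 0) • v := by
  have h := LinearMap.congr_fun (H.heis_comm a b m n) v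
  simp only [LinearMap.sub_apply, Module.End.mul_apply, LinearMap.smul_apply,
    Module.End.one_apply] at h
  rw [← h]; abel

theorem wa_perm (H : IsHeisenberg A hgen) {L L' : List (Fin ℓ × ℕ+)} (h : L.Perm L') (v : V) :
    wa A hgen L v = wa A hgen L' v := by
  induction h with
  | nil => rfl
  | cons x _ ih => obtain ⟨a, m⟩ := x; rw [wa_cons, wa_cons, ih]
  | swap x y L =>
    obtain ⟨a, m⟩ := x
    obtain ⟨b, n⟩ := y
    have hm := m.pos
    have hn := n.pos
    rw [wa_cons, wa_cons, wa_cons, wa_cons, comm_apply H, if_neg (by omega), zero_smul, add_zero]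
  | trans _ _ h1 h2 => rw [h1, h2]

theorem annih (H : IsHeisenberg A hgen) {r : ℤ} {p : Fin ℓ → ZMod 2} (a : Fin ℓ) (i : ℤ) (hi : 0 ≤ i) {v : V}
    (hv : v ∈ Fil A hgen r p) : A.Y (hgen a) i v ∈ Fil A hgen (r - 1) (ee a + p) := by
  refine Fil_le (N := (Fil A hgen (r - 1) (ee a + p)).comap (A.Y (hgen a) i)) ?_ hv
  intro L h1 h2
  rw [Submodule.mem_comap]
  clear hv
  induction L generalizing r p with
  | nil =>
    rw [wa_nil, A.create_ge _ _ hi]; exact Submodule.zero_mem _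
  | cons x L ih =>
    obtain ⟨b, n⟩ := x
    have hn := n.pos
    simp only [List.length_cons] at h1
    push_cast at h1
    rw [par_cons] at h2
    rw [wa_cons, comm_apply H]
    refine Submodule.add_mem _ ?_ ?_
    · have := ih (r := r - 1) (p := par L) (by omega) rfl
      refine Fil_mono (by omega) ?_ (creat b _ (by omega) this)
      rw [← h2]; abel
    · split_ifs with hab
      · refine Submodule.smul_mem _ _ (Fil_word L (by omega) ?_)
        rw [← h2, hab.1, ← add_assoc, dbl, zero_add]
      · rw [zero_smul]; exact Submodule.zero_mem _

theorem mode_word (H : IsHeisenberg A hgen) (L : List (Fin ℓ × ℕ+)) {s : ℤ} {q : Fin ℓ → ZMod 2} {v : V}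
    (hv : v ∈ Fil A hgen s q) (n : ℤ) :
    A.Y (wa A hgen L A.one) n v ∈ Fil A hgen (L.length + s) (par L + q) ∧
    (0 ≤ n → A.Y (wa A hgen L A.one) n v ∈ Fil A hgen (L.length + s - 2) (par L + q)) := by
  induction L generalizing s q v n with
  | nil =>
    rw [wa_nil, A.vacuum_act]
    constructor
    · split_ifs
      · exact Fil_mono (by simp) (by simp [par_nil]) hv
      · exact Submodule.zero_mem _
    · intro hn
      rw [if_neg (by omega)]
      exact Submodule.zero_mem _
  | cons x L ih =>
    obtain ⟨a, m⟩ := x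
    have hm := m.pos
    rw [wa_cons, iterate, par_cons]
    have h2 : ∀ i j : ℕ, A.Y (wa A hgen L A.one) (n + -((m : ℕ) : ℤ) - i) (A.Y (hgen a) j v)
        ∈ Fil A hgen (((a, m) :: L).length + s - 2) (ee a + par L + q) := by
      intro i j
      refine Fil_mono ?_ ?_ (ih (annih H a j (by omega) hv) _).1
      · simp only [List.length_cons]; push_cast; omega
      · abel
    constructor
    · refine finsum_mem_sub fun i => Submodule.smul_mem _ _ (Submodule.sub_mem _ ?_
        (Submodule.smul_mem _ _ (Fil_mono (by omega) rfl (h2 i i))))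
      refine Fil_mono ?_ ?_ (creat a _ (by omega) (ih hv _).1)
      · simp only [List.length_cons]; push_cast; omega
      · abel
    · intro hn
      refine finsum_mem_sub fun i => Submodule.smul_mem _ _ (Submodule.sub_mem _ ?_
        (Submodule.smul_mem _ _ (h2 i i)))
      refine Fil_mono ?_ ?_ (creat a _ (by omega) ((ih hv _).2 (by omega)))
      · simp only [List.length_cons]; push_cast; omega
      · abel

theorem mode_mem (H : IsHeisenberg A hgen) {r s : ℤ} {p q : Fin ℓ → ZMod 2} {u v : V} (hu : u ∈ Fil A hgen r p)
    (hv : v ∈ Fil A hgen s q) (n : ℤ) : A.Y u n v ∈ Fil A hgen (r + s) (p + q) := by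
  refine Fil_le (N := (Fil A hgen (r + s) (p + q)).comap
    ((LinearMap.applyₗ v).comp ((LinearMap.proj n).comp A.Y))) ?_ hu
  intro L h1 h2
  exact Fil_mono (by omega) (by rw [h2]) (mode_word H L hv n).1

theorem mode_mem' (H : IsHeisenberg A hgen) {r s : ℤ} {p q : Fin ℓ → ZMod 2} {u v : V} (hu : u ∈ Fil A hgen r p)
    (hv : v ∈ Fil A hgen s q) (n : ℤ) (hn : 0 ≤ n) :
    A.Y u n v ∈ Fil A hgen (r + s - 2) (p + q) := by
  refine Fil_le (N := (Fil A hgen (r + s - 2) (p + q)).comap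
    ((LinearMap.applyₗ v).comp ((LinearMap.proj n).comp A.Y))) ?_ hu
  intro L h1 h2
  exact Fil_mono (by omega) (by rw [h2]) ((mode_word H L hv n).2 hn)

/-- Leading term of a mode of a word, after peeling off one letter. -/
theorem peel (H : IsHeisenberg A hgen) (a : Fin ℓ) (m : ℕ+) (L : List (Fin ℓ × ℕ+)) {s : ℤ} {q : Fin ℓ → ZMod 2} {v : V}
    (hv : v ∈ Fil A hgen s q) (k : ℕ) :
    A.Y (wa A hgen ((a, m) :: L) A.one) (-k) v
      - ∑ i ∈ Finset.range k, ((-1 : ℂ) ^ i * zchoose (-((m : ℕ) : ℤ)) i) •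
          A.Y (hgen a) (-((m : ℕ) : ℤ) - i) (A.Y (wa A hgen L A.one) (-k + i) v)
      ∈ Fil A hgen (L.length + s - 1) (ee a + par L + q) := by
  have hm := m.pos
  rw [wa_cons]
  apply iterate_lead
  · intro i hi
    refine Fil_mono ?_ ?_ (creat a _ (by omega) ((mode_word H L hv _).2 (by omega)))
    · omega
    · abel
  · intro i
    refine Fil_mono ?_ ?_ (mode_word H L (annih H a i (by omega) hv) _).1
    · omega
    · abel

theorem lead_one (H : IsHeisenberg A hgen) (L : List (Fin ℓ × ℕ+)) {s : ℤ} {q : Fin ℓ → ZMod 2} {v : V}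
    (hv : v ∈ Fil A hgen s q) :
    A.Y (wa A hgen L A.one) (-1) v - wa A hgen L v
      ∈ Fil A hgen (L.length + s - 2) (par L + q) := by
  induction L with
  | nil => simp [wa_nil, A.vacuum_act]
  | cons x L ih =>
    obtain ⟨a, m⟩ := x
    have hm := m.pos
    have h1 := peel H a m L hv 1
    simp only [Finset.range_one, Finset.sum_singleton, pow_zero, zchoose_zero_right, mul_one,
      one_smul, Nat.cast_zero, sub_zero, add_zero, Nat.cast_one] at h1
    have h2 := creat a (-((m : ℕ) : ℤ)) (by omega) ih
    rw [map_sub, ← wa_cons] at h2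
    have h3 := Submodule.add_mem _ (Fil_mono (s := ((a, m) :: L).length + s - 2)
      (q := par ((a, m) :: L) + q) (by simp only [List.length_cons]; push_cast; omega)
        (by rw [par_cons]) h1) (Fil_mono (s := ((a, m) :: L).length + s - 2)
      (q := par ((a, m) :: L) + q) (by simp only [List.length_cons]; push_cast; omega)
        (by rw [par_cons]; abel) h2)
    simpa using h3

theorem lead_two (H : IsHeisenberg A hgen) (a b : Fin ℓ) (m n : ℕ+) {s : ℤ} {q : Fin ℓ → ZMod 2} {v : V}
    (hv : v ∈ Fil A hgen s q) :
    A.Y (wa A hgen [(a, m), (b, n)] A.one) (-2) v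
      - (((m : ℕ) : ℂ) • wa A hgen [(a, m + 1), (b, n)] v
        + ((n : ℕ) : ℂ) • wa A hgen [(a, m), (b, n + 1)] v)
      ∈ Fil A hgen s (ee a + ee b + q) := by
  have hm := m.pos
  have hn := n.pos
  have h1 := peel H a m [(b, n)] hv 2
  have h2 := peel H b n [] hv 2
  have h3 := lead_one H [(b, n)] hv
  have h2' := creat a (-((m : ℕ) : ℤ)) (by omega) h2
  have h3' := creat a (-((m : ℕ) : ℤ) - 1) (by omega) h3
  simp only [Finset.sum_range_succ, Finset.range_one, Finset.sum_singleton, pow_zero,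
    zchoose_zero_right, mul_one, one_smul, Nat.cast_zero, sub_zero, add_zero, Nat.cast_one,
    zchoose_one_right, pow_one, Nat.cast_ofNat, wa_nil, A.vacuum_act] at h1 h2'
  norm_num at h1 h2'
  rw [par_cons, par_nil, add_zero] at h1
  rw [par_nil, add_zero] at h2'
  rw [par_cons, par_nil, add_zero] at h3'
  have h1' := Fil_mono (s := s) (q := ee a + ee b + q) (by omega) rfl h1
  have h2'' := Fil_mono (s := s) (q := ee a + ee b + q) (by omega) (by abel) h2'
  have h3'' := Fil_mono (s := s) (q := ee a + ee b + q)
    (by simp only [List.length_cons, List.length_nil]; push_cast; omega) (by abel) h3'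
  have h4 := Submodule.add_mem _ (Submodule.add_mem _ h1' h2'')
    (Submodule.smul_mem _ ((m : ℕ) : ℂ) h3'')
  convert h4 using 1
  simp only [wa_cons, wa_nil, map_sub, smul_sub, PNat.add_coe, PNat.one_coe, map_smul]
  push_cast
  rw [show -(((m : ℕ) : ℤ) + 1) = -((m : ℕ) : ℤ) - 1 by ring,
    show -(((n : ℕ) : ℤ) + 1) = -((n : ℕ) : ℤ) - 1 by ring]
  abel

/-- Weight of a word. -/
theorem wa_wt (H : IsHeisenberg A hgen) (L : List (Fin ℓ × ℕ+)) : ∃ k : ℤ, wa A hgen L A.one ∈ A.wt k := by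
  induction L with
  | nil => exact ⟨0, A.one_wt⟩
  | cons x L ih =>
    obtain ⟨a, m⟩ := x
    obtain ⟨k, hk⟩ := ih
    exact ⟨_, A.mode_wt 1 (hgen a) (H.wt_one a) k _ _ hk⟩

theorem hcomp_Fil (H : IsHeisenberg A hgen) {r : ℤ} {p : Fin ℓ → ZMod 2} {v : V} (hv : v ∈ Fil A hgen r p) (k : ℤ) :
    A.hcomp k v ∈ Fil A hgen r p := by
  let f : V →ₗ[ℂ] V :=
    { toFun := A.hcomp k, map_add' := hcomp_add A k, map_smul' := hcomp_smul A k }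
  refine Fil_le (N := (Fil A hgen r p).comap f) ?_ hv
  intro L h1 h2
  obtain ⟨j, hj⟩ := wa_wt H L
  change A.hcomp k (wa A hgen L A.one) ∈ Fil A hgen r p
  rw [hcomp_of_mem A j k _ hj]
  split_ifs
  · exact Fil_word L h1 h2
  · exact Submodule.zero_mem _

end Heis

section Plus

variable {V W : Type} [AddCommGroup V] [Module ℂ V] [AddCommGroup W] [Module ℂ W] {ℓ : ℕ}
  (S : HeisenbergPlusSetting ℓ V W)

theorem theta_wa (L : List (Fin ℓ × ℕ+)) :
    S.θ (wa S.A S.hgen L S.A.one) = ((-1 : ℂ) ^ L.length) • wa S.A S.hgen L S.A.one := by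
  induction L with
  | nil => simp [wa_nil, S.thetaAut.map_one]
  | cons x L ih =>
    obtain ⟨a, m⟩ := x
    rw [wa_cons, S.thetaAut.map_Y, ih, S.thetaAut.map_gen]
    simp [pow_succ]

theorem exists_lift (L : List (Fin ℓ × ℕ+)) (h : Even L.length) :
    ∃ y : W, S.ι y = wa S.A S.hgen L S.A.one := by
  have : wa S.A S.hgen L S.A.one ∈ LinearMap.range S.ι := by
    rw [S.fixedSub.range_eq, Module.End.mem_eigenspace_iff]
    have := theta_wa S L
    rw [h.neg_one_pow] at this
    exact this
  exact this

theorem iota_hcomp (k : ℤ) (u : W) : S.ι (S.B.hcomp k u) = S.A.hcomp k (S.ι u) := by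
  obtain ⟨s, hs, hu⟩ := exists_support S.B u
  let f : V →ₗ[ℂ] V :=
    { toFun := S.A.hcomp k, map_add' := hcomp_add S.A k, map_smul' := hcomp_smul S.A k }
  have hf : S.A.hcomp k (S.ι u) = ∑ j ∈ s, S.A.hcomp k (S.ι (S.B.hcomp j u)) := by
    conv_lhs => rw [hu, map_sum]
    exact map_sum f _ _
  rw [hf]
  have hmem : ∀ j, S.ι (S.B.hcomp j u) ∈ S.A.wt j := fun j =>
    (S.fixedSub.map_wt j _).1 (S.B.decompose u j).2
  simp only [fun j => hcomp_of_mem S.A j k _ (hmem j)]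
  rw [Finset.sum_ite_eq]
  split_ifs with h
  · rfl
  · rw [hs k h, map_zero]

theorem star_lead_Fil {r s : ℤ} {p q : Fin ℓ → ZMod 2} {u v : W}
    (hu : S.ι u ∈ Fil S.A S.hgen r p) (hv : S.ι v ∈ Fil S.A S.hgen s q) :
    S.ι (S.B.star u v) - S.A.Y (S.ι u) (-1) (S.ι v) ∈ Fil S.A S.hgen (r + s - 2) (p + q) := by
  have := star_lead S.B ((Fil S.A S.hgen (r + s - 2) (p + q)).comap S.ι) u v (by
    intro k n hn
    rw [Submodule.mem_comap, S.fixedSub.map_Y, iota_hcomp]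
    exact mode_mem' S.heis (hcomp_Fil S.heis hu k) hv n hn)
  rwa [Submodule.mem_comap, map_sub, S.fixedSub.map_Y] at this

theorem star_Fil {r s : ℤ} {p q : Fin ℓ → ZMod 2} {u v : W}
    (hu : S.ι u ∈ Fil S.A S.hgen r p) (hv : S.ι v ∈ Fil S.A S.hgen s q) :
    S.ι (S.B.star u v) ∈ Fil S.A S.hgen (r + s) (p + q) := by
  have h1 := Fil_mono (s := r + s) (q := p + q) (by omega) rfl (star_lead_Fil S hu hv)
  have h2 := Submodule.add_mem _ h1 (mode_mem S.heis hu hv (-1))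
  simpa using h2

/-- If `u` and `v` have leading words `L`, `L'`, then `u * v` has leading word `L ++ L'`. -/
theorem star_word {r s : ℤ} (L L' : List (Fin ℓ × ℕ+)) {u v : W}
    (hr : r = L.length) (hs : s = L'.length)
    (hu : S.ι u - wa S.A S.hgen L S.A.one ∈ Fil S.A S.hgen (r - 2) (par L))
    (hv : S.ι v - wa S.A S.hgen L' S.A.one ∈ Fil S.A S.hgen (s - 2) (par L')) :
    S.ι (S.B.star u v) - wa S.A S.hgen (L ++ L') S.A.one
      ∈ Fil S.A S.hgen (r + s - 2) (par (L ++ L')) := by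
  have hL : wa S.A S.hgen L S.A.one ∈ Fil S.A S.hgen r (par L) := Fil_word L (by omega) rfl
  have hL' : wa S.A S.hgen L' S.A.one ∈ Fil S.A S.hgen s (par L') := Fil_word L' (by omega) rfl
  have hu' : S.ι u ∈ Fil S.A S.hgen r (par L) := by
    have := Submodule.add_mem _ (Fil_mono (s := r) (by omega) rfl hu) hL
    simpa using this
  have hv' : S.ι v ∈ Fil S.A S.hgen s (par L') := by
    have := Submodule.add_mem _ (Fil_mono (s := s) (by omega) rfl hv) hL'
    simpa using this
  rw [par_append]
  have h1 := star_lead_Fil S hu' hv'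
  have h2 := Fil_mono (s := r + s - 2) (by omega) rfl (mode_mem S.heis hu hv' (-1))
  have h3 := Fil_mono (s := r + s - 2) (by omega) rfl (mode_mem S.heis hL hv (-1))
  have h4 := Fil_mono (s := r + s - 2) (by omega) rfl (lead_one S.heis L hL')
  have h5 := Submodule.add_mem _ (Submodule.add_mem _ h1 h2) (Submodule.add_mem _ h3 h4)
  convert h5 using 1
  rw [wa_append]
  simp only [map_sub, Pi.sub_apply, LinearMap.sub_apply]
  abel

theorem circ_mem {N : Submodule ℂ V} (hN : S.B.Osub.map S.ι ≤ N) (a b : Fin ℓ) (m n : ℕ+)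
    (L : List (Fin ℓ × ℕ+)) (hL : Even L.length)
    (hF : ∀ v, v ∈ Fil S.A S.hgen L.length (par ((a, m) :: (b, n) :: L)) → v ∈ N)
    (hw : wa S.A S.hgen ((a, m) :: (b, n) :: L) S.A.one ∈ N) :
    ((m : ℕ) : ℂ) • wa S.A S.hgen ((a, m + 1) :: (b, n) :: L) S.A.one
      + ((n : ℕ) : ℂ) • wa S.A S.hgen ((a, m) :: (b, n + 1) :: L) S.A.one ∈ N := by
  obtain ⟨u, hu⟩ := exists_lift S [(a, m), (b, n)] (by simp)
  obtain ⟨v, hv⟩ := exists_lift S L hL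
  obtain ⟨k, hk⟩ := wa_wt S.heis [(a, m), (b, n)]
  have hO : S.ι (S.B.circAux k u v) ∈ N := by
    apply hN
    refine Submodule.mem_map_of_mem (Submodule.subset_span ⟨k, u, v, ?_, rfl⟩)
    rw [S.fixedSub.map_wt, hu]; exact hk
  have hp : par ((a, m) :: (b, n) :: L) = ee a + ee b + par L := by
    rw [par_cons, par_cons, add_assoc]
  rw [hp] at hF
  have hvF : wa S.A S.hgen L S.A.one ∈ Fil S.A S.hgen L.length (par L) := Fil_word L le_rfl rfl
  have hp2 : par [(a, m), (b, n)] = ee a + ee b := by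
    rw [par_cons, par_cons, par_nil, add_zero]
  have h1 := circ_lead S.B (N.comap S.ι) k u v (by
    intro j hj
    rw [Submodule.mem_comap, S.fixedSub.map_Y, hu, hv]
    refine hF _ (Fil_mono ?_ ?_ ((mode_word S.heis [(a, m), (b, n)] hvF j).2 hj))
    · simp only [List.length_cons, List.length_nil]; push_cast; omega
    · rw [hp2])
  rw [Submodule.mem_comap, map_sub, map_add, map_smul, S.fixedSub.map_Y, S.fixedSub.map_Y,
    hu, hv] at h1
  have h2 := hF _ (Fil_mono (by simp only [List.length_cons, List.length_nil]; push_cast; omega)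
    (by rw [hp2]) (lead_one S.heis [(a, m), (b, n)] hvF))
  have h3 := hF _ (lead_two S.heis a b m n hvF)
  have e : ∀ x y, wa S.A S.hgen [x, y] (wa S.A S.hgen L S.A.one)
      = wa S.A S.hgen (x :: y :: L) S.A.one := by
    intro x y
    rw [← wa_append]; rfl
  simp only [e] at h2 h3
  have h4 := N.sub_mem (N.sub_mem (N.sub_mem (N.sub_mem hO h1) h3)
    (N.smul_mem (k : ℂ) h2)) (N.smul_mem (k : ℂ) hw)
  convert h4 using 1
  rw [smul_sub]
  abel

theorem reduce {N : Submodule ℂ V} (hN : S.B.Osub.map S.ι ≤ N) (a b c : Fin ℓ) (m n k : ℕ+)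
    (L : List (Fin ℓ × ℕ+)) (hL : Even (L.length + 1))
    (hF : ∀ v, v ∈ Fil S.A S.hgen (L.length + 1) (par ((a, m) :: (b, n) :: (c, k) :: L)) → v ∈ N)
    (hw : wa S.A S.hgen ((a, m) :: (b, n) :: (c, k) :: L) S.A.one ∈ N) :
    wa S.A S.hgen ((a, m + 1) :: (b, n) :: (c, k) :: L) S.A.one ∈ N := by
  have hm := m.pos
  have h1 := circ_mem S hN a b m n ((c, k) :: L) hL
    (by simpa using hF) hw
  have P2 : ∀ x y z : Fin ℓ × ℕ+, (x :: y :: z :: L).Perm (x :: z :: y :: L) :=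
    fun x y z => List.Perm.cons _ (List.Perm.swap _ _ _)
  have P3 : ∀ x y z : Fin ℓ × ℕ+, (x :: y :: z :: L).Perm (y :: z :: x :: L) :=
    fun x y z => (List.Perm.swap _ _ _).trans (P2 _ _ _)
  have h2 := circ_mem S hN a c m k ((b, n) :: L) hL
    (by rw [← par_perm (P2 _ _ _)]; simpa using hF) (by rwa [← wa_perm S.heis (P2 _ _ _)])
  have h3 := circ_mem S hN b c n k ((a, m) :: L) hL
    (by rw [← par_perm (P3 _ _ _)]; simpa using hF) (by rwa [← wa_perm S.heis (P3 _ _ _)])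
  rw [← wa_perm S.heis (P2 (a, m + 1) (b, n) (c, k)),
    ← wa_perm S.heis (P2 (a, m) (b, n) (c, k + 1))] at h2
  rw [← wa_perm S.heis (P3 (a, m) (b, n + 1) (c, k)),
    ← wa_perm S.heis (P3 (a, m) (b, n) (c, k + 1))] at h3
  have h4 := N.sub_mem (N.add_mem h1 h2) h3
  have h5 : (2 * ((m : ℕ) : ℂ)) • wa S.A S.hgen ((a, m + 1) :: (b, n) :: (c, k) :: L) S.A.one
      ∈ N := by
    convert h4 using 1
    module
  have hne : (2 * ((m : ℕ) : ℂ)) ≠ 0 := by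
    have : ((m : ℕ) : ℂ) ≠ 0 := by exact_mod_cast hm.ne'
    simpa using this
  exact (N.smul_mem_iff hne).1 h5

/-- Sum of modes. -/
def wsum (L : List (Fin ℓ × ℕ+)) : ℕ := (L.map fun x => (x.2 : ℕ)).sum

theorem wsum_perm {L L' : List (Fin ℓ × ℕ+)} (h : L.Perm L') : wsum L = wsum L' :=
  (h.map _).sum_eq

theorem par_sum (L : List (Fin ℓ × ℕ+)) : ∑ c, par L c = (L.length : ZMod 2) := by
  induction L with
  | nil => simp [par_nil]
  | cons x L ih =>
    obtain ⟨a, m⟩ := x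
    rw [par_cons]
    simp only [Pi.add_apply, Finset.sum_add_distrib, ih, ee]
    rw [Finset.sum_pi_single']
    simp [add_comm]

/-- The main induction. -/
theorem all_words {N : Submodule ℂ V} (hN : S.B.Osub.map S.ι ≤ N) (P : List (Fin ℓ × ℕ+))
    (hP1 : ∀ x ∈ P, x.2 = 1) (hP2 : 4 ≤ P.length) (hP3 : P.Nodup) (hP4 : Even P.length)
    (hstep : ∀ L : List (Fin ℓ × ℕ+), par L = 0 →
      (∀ v ∈ Fil S.A S.hgen ((P ++ L).length - 2) (par P), v ∈ N) →
        wa S.A S.hgen (P ++ L) S.A.one ∈ N) :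
    ∀ (r w : ℕ) (L : List (Fin ℓ × ℕ+)), L.length ≤ r → wsum L ≤ w → par L = par P →
      wa S.A S.hgen L S.A.one ∈ N := by
  classical
  have hsub : ∀ L : List (Fin ℓ × ℕ+), par L = par P → ∀ c ∈ P.map Prod.fst,
      c ∈ L.map Prod.fst := by
    intro L hL c hc
    by_contra hcon
    have h0 : par L c = 0 := by simp [par, List.count_eq_zero_of_not_mem hcon]
    have hnd : (P.map Prod.fst).Nodup := by
      refine List.Nodup.map_on ?_ hP3
      intro x hx y hy hxy
      exact Prod.ext hxy ((hP1 x hx).trans (hP1 y hy).symm)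
    have h1 : par P c = 1 := by simp [par, List.count_eq_one_of_mem hnd hc]
    rw [hL, h1] at h0
    exact one_ne_zero h0
  have hnd : (P.map Prod.fst).Nodup := by
    refine List.Nodup.map_on ?_ hP3
    intro x hx y hy hxy
    exact Prod.ext hxy ((hP1 x hx).trans (hP1 y hy).symm)
  have hlen : ∀ L : List (Fin ℓ × ℕ+), par L = par P → 4 ≤ L.length ∧ Even L.length := by
    intro L hL
    constructor
    · have := (List.subperm_of_subset hnd (hsub L hL)).length_le
      simp only [List.length_map] at this
      omega
    · have h1 := par_sum L
      rw [hL, par_sum P] at h1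
      have h2 : ((P.length : ℕ) : ZMod 2) = 0 := (ZMod.natCast_eq_zero_iff_even).2 hP4
      rw [h2] at h1
      exact (ZMod.natCast_eq_zero_iff_even).1 h1.symm
  intro r
  induction r with
  | zero =>
    intro w L h1 _ h3
    have := (hlen L h3).1
    omega
  | succ r ihr =>
    intro w
    induction w with
    | zero =>
      intro L h1 h2 h3
      exfalso
      have h4 := (hlen L h3).1
      match L, h4, h2 with
      | x :: L, _, h2 =>
        have := x.2.pos
        simp [wsum] at h2
    | succ w ihw =>
      intro L h1 h2 h3
      have hFN : ∀ v ∈ Fil S.A S.hgen ((L.length : ℤ) - 2) (par P), v ∈ N := by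
        intro v hv
        refine Fil_le ?_ hv
        intro L' h1' h2'
        exact ihr (wsum L') L' (by omega) le_rfl h2'
      obtain ⟨hl4, hle⟩ := hlen L h3
      by_cases hall : ∀ x ∈ L, x.2 = 1
      · have hPL : P.Subperm L := by
          apply List.subperm_of_subset hP3
          intro x hx
          obtain ⟨y, hy, hyx⟩ := List.mem_map.1 (hsub L h3 x.1 (List.mem_map_of_mem hx))
          have : y = x := Prod.ext hyx ((hall y hy).trans (hP1 x hx).symm)
          rwa [← this]
        obtain ⟨l, hl1, hl2⟩ := hPL
        obtain ⟨L', hL'⟩ := hl2.exists_perm_append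
        replace hL' := hL'.trans (hl1.append_right L')
        rw [wa_perm S.heis hL']
        apply hstep
        · have := par_perm hL'
          rw [par_append, h3] at this
          exact left_eq_add.1 this
        · rw [← hL'.length_eq]
          exact hFN
      · push Not at hall
        obtain ⟨⟨a, m⟩, hx, hm⟩ := hall
        have hperm := List.perm_cons_erase hx
        have hl : (L.erase (a, m)).length + 1 = L.length := by
          have := hperm.length_eq
          simpa using this.symm
        match hE : L.erase (a, m), hl with
        | [], hl => simp at hl; omega
        | [_], hl => simp at hl; omega
        | (b, n) :: (c, k) :: L', hl =>
          rw [hE] at hperm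
          obtain ⟨m', rfl⟩ : ∃ m' : ℕ+, m = m' + 1 := by
            obtain ⟨m', h⟩ := PNat.exists_eq_succ_of_ne_one hm
            exact ⟨m', h⟩
          rw [wa_perm S.heis hperm]
          have hp := par_perm hperm
          have hlen3 : L.length = L'.length + 3 := by
            have := hperm.length_eq
            simpa using this
          have hws := wsum_perm hperm
          have hpar : par ((a, m') :: (b, n) :: (c, k) :: L') = par P := by
            rw [← h3, hp, par_cons, par_cons a (m' + 1)]
          apply reduce S hN
          · rw [show L.length = (L'.length + 1) + 2 by omega] at hle
            simpa [Nat.even_add] using hle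
          · rw [hpar]
            intro v hv
            exact hFN v (Fil_mono (by omega) rfl hv)
          · apply ihw
            · simp only [List.length_cons]; omega
            · simp [wsum] at hws h2 ⊢
              omega
            · exact hpar

theorem exists_Fil {α : Finset (Fin ℓ)} {v : V} (hv : v ∈ wordSpanV S.A S.hgen α)
    {p : Fin ℓ → ZMod 2} (hp : ∀ c, p c = if c ∈ α then 1 else 0) :
    ∃ r : ℤ, v ∈ Fil S.A S.hgen r p := by
  unfold wordSpanV at hv
  induction hv using Submodule.span_induction with
  | mem x hx =>
    obtain ⟨L, h1, rfl⟩ := hx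
    refine ⟨L.length, Fil_word L le_rfl ?_⟩
    funext c
    rw [hp]
    split_ifs with h
    · have := (h1 c).1 h
      exact (ZMod.natCast_eq_one_iff_odd).2 (Nat.not_even_iff_odd.1 this)
    · have : Even ((L.map Prod.fst).count c) := by
        by_contra h2
        exact h ((h1 c).2 h2)
      exact (ZMod.natCast_eq_zero_iff_even).2 this
  | zero => exact ⟨0, Submodule.zero_mem _⟩
  | add x y _ _ hx hy =>
    obtain ⟨r, hr⟩ := hx
    obtain ⟨s, hs⟩ := hy
    exact ⟨max r s, Submodule.add_mem _ (Fil_mono (le_max_left _ _) rfl hr)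
      (Fil_mono (le_max_right _ _) rfl hs)⟩
  | smul c x _ hx =>
    obtain ⟨r, hr⟩ := hx
    exact ⟨r, Submodule.smul_mem _ _ hr⟩

theorem Fil_wordSpan {α : Finset (Fin ℓ)} {v : V} {r : ℤ} {p : Fin ℓ → ZMod 2}
    (hv : v ∈ Fil S.A S.hgen r p) (hp : ∀ c, p c = if c ∈ α then 1 else 0) :
    v ∈ wordSpanV S.A S.hgen α := by
  refine Fil_le ?_ hv
  intro L _ h2
  refine Submodule.subset_span ⟨L, fun c => ?_, rfl⟩
  have h3 := hp c
  rw [← h2] at h3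
  unfold par at h3
  rw [← ZMod.natCast_eq_zero_iff_even, h3]
  split_ifs with h <;> simp [h]

/-- Leading word of the iterated product of the `S_{ab}`. -/
theorem starList_lead (s : Fin ℓ → Fin ℓ → ℤ → ℤ → W)
    (hs : ∀ a b m n, S.ι (s a b m n) = SV S.A S.hgen a b m n)
    (Q : List (Fin ℓ × Fin ℓ)) (P : List (Fin ℓ × ℕ+))
    (hP : P = Q.flatMap fun q => [(q.1, 1), (q.2, 1)]) :
    S.ι (starList S.B (Q.map fun q => s q.1 q.2 1 1)) - wa S.A S.hgen P S.A.one
      ∈ Fil S.A S.hgen (P.length - 2) (par P) := by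
  induction Q generalizing P with
  | nil =>
    subst hP
    simp [starList, wa_nil, S.fixedSub.map_one]
  | cons q Q ih =>
    have h1 := ih _ rfl
    have h2 : S.ι (s q.1 q.2 1 1) - wa S.A S.hgen [(q.1, 1), (q.2, 1)] S.A.one
      ∈ Fil S.A S.hgen ((([(q.1, 1), (q.2, 1)] : List (Fin ℓ × ℕ+)).length : ℤ) - 2)
        (par [(q.1, 1), (q.2, 1)]) := by
      rw [hs]
      have : wa S.A S.hgen [(q.1, 1), (q.2, 1)] S.A.one = SV S.A S.hgen q.1 q.2 1 1 := by
        simp [wa_cons, wa_nil, SV]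
      rw [this, sub_self]
      exact Submodule.zero_mem _
    have h3 := star_word S _ _ rfl rfl h2 h1
    rw [List.flatMap_cons] at hP
    rw [← hP] at h3
    refine Fil_mono ?_ rfl h3
    rw [hP, List.length_append]
    push_cast
    omega

end Plus

end H11

/-- Proposition 4.1.11. Let `α ⊆ {1,…,ℓ}` with `|α| = 2k`
even and `≥ 4` (here `α` is the image of an injective `a : Fin (2k) → Fin ℓ`,
partitioned into 2-element subsets by `pairs`). Then, as a left and as a right
`A[𝓦]`-module, `A[𝓦^α]` is generated by the single element
`S_α = S_{α_1} * ⋯ * S_{α_k} + O(𝓗⁺)`, where `S_{{a,b}} = h_a(-1)h_b(-1)𝟏`. -/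
theorem statement11 (ℓ k : ℕ) (hk : 2 ≤ k) {V W : Type} [AddCommGroup V]
    [Module ℂ V] [AddCommGroup W] [Module ℂ W] (S : HeisenbergPlusSetting ℓ V W)
    (s : Fin ℓ → Fin ℓ → ℤ → ℤ → W)
    (hs : ∀ a b m n, S.ι (s a b m n) = SV S.A S.hgen a b m n)
    (a : Fin (2 * k) → Fin ℓ) (ha : Function.Injective a)
    (pairs : Fin k → Fin ℓ × Fin ℓ)
    (hp : (List.ofFn a).Perm ((List.ofFn pairs).flatMap fun q => [q.1, q.2])) :
    let SA : W := starList S.B (List.ofFn fun i => s (pairs i).1 (pairs i).2 1 1)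
    let Wsp : Submodule ℂ V := wordSpanV S.A S.hgen (∅ : Finset (Fin ℓ))
    let Walpha : Submodule ℂ V :=
      wordSpanV S.A S.hgen (Finset.image a Finset.univ)
    let Sright : Submodule ℂ W := Submodule.span ℂ
      {z : W | ∃ y : W, S.ι y ∈ Wsp ∧ z = S.B.star SA y}
    let Sleft : Submodule ℂ W := Submodule.span ℂ
      {z : W | ∃ y : W, S.ι y ∈ Wsp ∧ z = S.B.star y SA}
    (∀ x : W, S.ι x ∈ Walpha →
      (∃ z ∈ Sright, x - z ∈ S.B.Osub) ∧ (∃ z ∈ Sleft, x - z ∈ S.B.Osub)) ∧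
    (∀ z : W, z ∈ Sright ∨ z ∈ Sleft →
      ∃ x : W, S.ι x ∈ Walpha ∧ z - x ∈ S.B.Osub) := by
  classical
  intro SA Wsp Walpha Sright Sleft
  set Q := List.ofFn pairs with hQ
  let P : List (Fin ℓ × ℕ+) := Q.flatMap fun q => [(q.1, 1), (q.2, 1)]
  have hPfst : P.map Prod.fst = Q.flatMap fun q => [q.1, q.2] := by
    simp [P, List.map_flatMap]
  have hPperm : (List.ofFn a).Perm (P.map Prod.fst) := hPfst ▸ hp
  have hPlen : P.length = 2 * k := by
    have := hPperm.length_eq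
    simpa using this.symm
  have hndf : (P.map Prod.fst).Nodup := hPperm.nodup_iff.1 (List.nodup_ofFn.2 ha)
  have hPnd : P.Nodup := List.Nodup.of_map _ hndf
  have hP1 : ∀ x ∈ P, x.2 = 1 := by
    intro x hx
    obtain ⟨q, _, hq⟩ := List.mem_flatMap.1 hx
    simp only [List.mem_cons, List.not_mem_nil, or_false] at hq
    rcases hq with rfl | rfl <;> rfl
  have hparP : ∀ c, H11.par P c = if c ∈ Finset.image a Finset.univ then 1 else 0 := by
    intro c
    have hmem : c ∈ P.map Prod.fst ↔ c ∈ Finset.image a Finset.univ := by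
      rw [← hPperm.mem_iff]; simp [List.mem_ofFn]
    split_ifs with h
    · rw [← hmem] at h
      simp [H11.par, List.count_eq_one_of_mem hndf h]
    · rw [← hmem] at h
      simp [H11.par, List.count_eq_zero_of_not_mem h]
  have hSA : S.ι SA - H11.wa S.A S.hgen P S.A.one
      ∈ H11.Fil S.A S.hgen (P.length - 2) (H11.par P) := by
    have := H11.starList_lead S s hs Q P rfl
    rw [hQ, List.map_ofFn] at this
    exact this
  have hSA' : S.ι SA ∈ H11.Fil S.A S.hgen P.length (H11.par P) := by
    have := Submodule.add_mem _ (H11.Fil_mono (s := P.length) (by omega) rfl hSA)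
      (H11.Fil_word (A := S.A) (hgen := S.hgen) P le_rfl rfl)
    simpa using this
  have hlenE : ∀ L : List (Fin ℓ × ℕ+), H11.par L = 0 → Even L.length := by
    intro L hL
    have h1 := H11.par_sum L
    rw [hL] at h1
    simp only [Pi.zero_apply, Finset.sum_const_zero] at h1
    exact (ZMod.natCast_eq_zero_iff_even).1 h1.symm
  have h0 : ∀ c : Fin ℓ, (0 : Fin ℓ → ZMod 2) c = if c ∈ (∅ : Finset (Fin ℓ)) then 1 else 0 := by
    intro c; simp
  have key : ∀ T : Submodule ℂ W,
      (∀ L : List (Fin ℓ × ℕ+), H11.par L = 0 →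
        (∃ z ∈ T, S.ι z - H11.wa S.A S.hgen (P ++ L) S.A.one
          ∈ H11.Fil S.A S.hgen ((P ++ L).length - 2) (H11.par P))) →
      ∀ x : W, S.ι x ∈ Walpha → ∃ z ∈ T, x - z ∈ S.B.Osub := by
    intro T hT x hx
    obtain ⟨r, hr⟩ := H11.exists_Fil S hx hparP
    have hN : S.B.Osub.map S.ι ≤ (T ⊔ S.B.Osub).map S.ι := Submodule.map_mono le_sup_right
    have hall := H11.all_words S hN P hP1 (by omega) hPnd (by rw [hPlen]; simp)
      (by
        intro L hL hF
        obtain ⟨z, hz, hz'⟩ := hT L hL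
        have h1 := hF _ hz'
        have h2 : S.ι z ∈ (T ⊔ S.B.Osub).map S.ι :=
          Submodule.mem_map_of_mem (Submodule.mem_sup_left hz)
        have h3 := Submodule.sub_mem _ h2 h1
        simpa using h3)
    have hxN : S.ι x ∈ (T ⊔ S.B.Osub).map S.ι :=
      H11.Fil_le (fun L _ h2 => hall _ _ L le_rfl le_rfl h2) hr
    obtain ⟨t, ht, htx⟩ := hxN
    have := S.fixedSub.inj htx
    subst this
    obtain ⟨z, hz, o, ho, rfl⟩ := Submodule.mem_sup.1 ht
    exact ⟨z, hz, by simpa using ho⟩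
  constructor
  · intro x hx
    constructor
    · refine key Sright ?_ x hx
      intro L hL
      obtain ⟨y, hy⟩ := H11.exists_lift S L (hlenE L hL)
      refine ⟨S.B.star SA y, Submodule.subset_span ⟨y, ?_, rfl⟩, ?_⟩
      · rw [hy]
        exact H11.Fil_wordSpan S (H11.Fil_word L le_rfl hL) h0
      · have := H11.star_word S P L (u := SA) (v := y) rfl rfl hSA (by simp [hy])
        refine H11.Fil_mono ?_ ?_ this
        · rw [List.length_append]; push_cast; omega
        · rw [H11.par_append, hL, add_zero]
    · refine key Sleft ?_ x hx
      intro L hL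
      obtain ⟨y, hy⟩ := H11.exists_lift S L (hlenE L hL)
      refine ⟨S.B.star y SA, Submodule.subset_span ⟨y, ?_, rfl⟩, ?_⟩
      · rw [hy]
        exact H11.Fil_wordSpan S (H11.Fil_word L le_rfl hL) h0
      · have := H11.star_word S L P (u := y) (v := SA) rfl rfl (by simp [hy]) hSA
        rw [H11.wa_perm S.heis (List.perm_append_comm (l₁ := P) (l₂ := L))]
        refine H11.Fil_mono ?_ ?_ this
        · rw [List.length_append]; push_cast; omega
        · rw [H11.par_append, hL, zero_add]
  · intro z hz
    refine ⟨z, ?_, by simp⟩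
    rcases hz with hz | hz
    · refine (Submodule.span_le (p := Walpha.comap S.ι)).2 ?_ hz
      rintro _ ⟨y, hy, rfl⟩
      obtain ⟨r, hr⟩ := H11.exists_Fil S hy h0
      have := H11.star_Fil S hSA' hr
      rw [add_zero] at this
      exact H11.Fil_wordSpan S this hparP
    · refine (Submodule.span_le (p := Walpha.comap S.ι)).2 ?_ hz
      rintro _ ⟨y, hy, rfl⟩
      obtain ⟨r, hr⟩ := H11.exists_Fil S hy h0
      have := H11.star_Fil S hr hSA'
      rw [zero_add] at this
      exact H11.Fil_wordSpan S this hparP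
end
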